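/- arXiv:math/0610895 — 2 statements merged into one kernel-verified Lean document; each statement's English description precedes it below -/
import Mathlib

section
/- Every finite-dimensional left U-module on which both K and H act semisimply is completely reducible, i.e. it is a direct sum of simple U-submodules. -/
set_option synthInstance.maxHeartbeats 1000000
set_option maxHeartbeats 1000000

noncomputable section

open FreeAlgebra

/-- Generators of the quantum group `U_q(f(K,H))`. -/
inductive Gen : Type
  | E | F | K | Kinv | H | Hinv

/-- The free algebra on the generators. -/
abbrev FA : Type := FreeAlgebra ℂ Gen

def gE : FA := ι ℂ Gen.E
def gF : FA := ι ℂ Gen.F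
def gK : FA := ι ℂ Gen.K
def gKi : FA := ι ℂ Gen.Kinv
def gH : FA := ι ℂ Gen.H
def gHi : FA := ι ℂ Gen.Hinv

/-- The defining relations of `U_q(f(K,H))`, where `r` is the element of the free
algebra representing the Laurent polynomial `f(K,H)` appearing in `EF - FE = f(K,H)`. -/
inductive URel (q : ℂ) (r : FA) : FA → FA → Prop
  | KKi : URel q r (gK * gKi) 1
  | KiK : URel q r (gKi * gK) 1
  | HHi : URel q r (gH * gHi) 1
  | HiH : URel q r (gHi * gH) 1
  | KH  : URel q r (gK * gH) (gH * gK)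
  | KE  : URel q r (gK * gE) (q ^ 2 • (gE * gK))
  | KF  : URel q r (gK * gF) ((q ^ 2)⁻¹ • (gF * gK))
  | HE  : URel q r (gH * gE) ((q ^ 2)⁻¹ • (gE * gH))
  | HF  : URel q r (gH * gF) (q ^ 2 • (gF * gH))
  | EF  : URel q r (gE * gF - gF * gE) r

/-- `U_q(f(K,H))` as a quotient of the free algebra. -/
abbrev Uq (q : ℂ) (r : FA) : Type := RingQuot (URel q r)

variable (q : ℂ) (r : FA)

def uE : Uq q r := RingQuot.mkAlgHom ℂ (URel q r) gE
def uF : Uq q r := RingQuot.mkAlgHom ℂ (URel q r) gF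
def uK : Uq q r := RingQuot.mkAlgHom ℂ (URel q r) gK
def uKi : Uq q r := RingQuot.mkAlgHom ℂ (URel q r) gKi
def uH : Uq q r := RingQuot.mkAlgHom ℂ (URel q r) gH
def uHi : Uq q r := RingQuot.mkAlgHom ℂ (URel q r) gHi

/-- The element `f_m(K,H) = (K^m - H^m)/(q - q⁻¹)` of the free algebra. -/
def fm (q : ℂ) (m : ℕ) : FA := (q - q⁻¹)⁻¹ • (gK ^ m - gH ^ m)

/-- The quantum group `U_q(f_m(K,H))`. -/
abbrev Um (q : ℂ) (m : ℕ) : Type := Uq q (fm q m)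

end
/-- `u ∈ U` acts semisimply (diagonalizably) on the `U`-module `V`: every vector is a
sum of eigenvectors of `u` (with eigenvalues in `ℂ`). -/
def ActsDiag (q : ℂ) (m : ℕ) (V : Type*) [AddCommGroup V] [Module (Um q m) V]
    (u : Um q m) : Prop :=
  ∀ v : V, v ∈ AddSubgroup.closure
    {w : V | ∃ a : ℂ, u • w = algebraMap ℂ (Um q m) a • w}

/-- A submodule stable under two commuting diagonalizable operators is contained in any submodule
that contains all of its joint eigenvectors. -/
theorem le_of_forall_joint_eigenvector {V : Type*} [AddCommGroup V] [Module ℂ V]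
    [FiniteDimensional ℂ V] {A B : Module.End ℂ V} (hAB : ∀ x, A (B x) = B (A x))
    (hA : ⨆ μ, A.eigenspace μ = ⊤) (hB : ⨆ μ, B.eigenspace μ = ⊤) {P Q : Submodule ℂ V}
    (hPA : ∀ x ∈ P, A x ∈ P) (hPB : ∀ x ∈ P, B x ∈ P)
    (h : ∀ x ∈ P, ∀ a b : ℂ, A x = a • x → B x = b • x → x ∈ Q) : P ≤ Q := by
  rw [Submodule.eq_iSup_inf_genEigenspace 1 hPA hA]
  refine iSup_le fun a ↦ ?_
  have hstab : ∀ x ∈ P ⊓ A.genEigenspace a 1, B x ∈ P ⊓ A.genEigenspace a 1 := by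
    rintro x ⟨hx, hxa⟩
    refine ⟨hPB x hx, ?_⟩
    have hxa' := Module.End.mem_eigenspace_iff.1 hxa
    exact Module.End.mem_eigenspace_iff.2 (by rw [hAB, hxa', map_smul])
  rw [Submodule.eq_iSup_inf_genEigenspace 1 hstab hB]
  refine iSup_le fun b ↦ ?_
  rintro x ⟨⟨hx, hxa⟩, hxb⟩
  exact h x hx a b (Module.End.mem_eigenspace_iff.1 hxa) (Module.End.mem_eigenspace_iff.1 hxb)

/-- An operator shifting the eigenvalues of an invertible diagonalizable operator by a factor that
is not a root of unity is nilpotent. -/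
theorem isNilpotent_of_eigenvalue_shift {V : Type*} [AddCommGroup V] [Module ℂ V]
    [FiniteDimensional ℂ V] {A E : Module.End ℂ V} {t : ℂ} (ht0 : t ≠ 0)
    (ht : ∀ n : ℕ, 0 < n → t ^ n ≠ 1) (hinj : ∀ x, A x = 0 → x = 0)
    (hA : ⨆ μ, A.eigenspace μ = ⊤) (hAE : ∀ x, A (E x) = t • E (A x)) : IsNilpotent E := by
  rw [Module.End.isNilpotent_iff_of_finite]
  intro v
  have hv : v ∈ ⨆ μ, A.eigenspace μ := hA ▸ Submodule.mem_top
  induction hv using Submodule.iSup_induction' with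
  | zero => exact ⟨0, by simp⟩
  | add x y _ _ hx hy =>
    obtain ⟨n, hn⟩ := hx
    obtain ⟨k, hk⟩ := hy
    refine ⟨n + k, ?_⟩
    have h1 : (E ^ (n + k)) x = 0 := by rw [add_comm, pow_add, Module.End.mul_apply, hn, map_zero]
    have h2 : (E ^ (n + k)) y = 0 := by rw [pow_add, Module.End.mul_apply, hk, map_zero]
    rw [map_add, h1, h2, add_zero]
  | mem a x hx =>
    by_contra! hne
    have hxa : A x = a • x := Module.End.mem_eigenspace_iff.1 hx
    have hx0 : x ≠ 0 := by simpa using hne 0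
    have ha : a ≠ 0 := fun h ↦ hx0 (hinj x (by rw [hxa, h, zero_smul]))
    have hpow : ∀ k : ℕ, A ((E ^ k) x) = (t ^ k * a) • (E ^ k) x := by
      intro k
      induction k with
      | zero => simpa using hxa
      | succ k ih =>
        rw [pow_succ', Module.End.mul_apply, hAE, ih, map_smul, smul_smul]
        congr 1
        ring
    have hmem : ∀ k : ℕ, t ^ k * a ∈ {μ | A.HasEigenvalue μ} := fun k ↦
      Module.End.hasEigenvalue_of_hasEigenvector
        (x := (E ^ k) x) ⟨Module.End.mem_eigenspace_iff.2 (hpow k), hne k⟩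
    have hinj' : Function.Injective fun k : ℕ ↦ t ^ k * a := by
      refine Function.Injective.of_lt_imp_ne fun i j hij h ↦ ?_
      have h' : t ^ i = t ^ j := mul_right_cancel₀ ha h
      refine ht (j - i) (by omega) (mul_left_cancel₀ (pow_ne_zero i ht0) ?_)
      rw [← pow_add, mul_one, Nat.add_sub_cancel' hij.le, h']
    exact (Set.infinite_of_injective_forall_mem hinj' hmem) A.finite_hasEigenvalue

/-- Operators on a vector space satisfying the relations of `U_q(f_m(K,H))`, where `A`, `B` play
the role of `K ^ m`, `H ^ m`, act invertibly and diagonalizably, and `t = q ^ (2 * m)`. -/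
structure IsWeightTuple {V : Type*} [AddCommGroup V] [Module ℂ V] (t d : ℂ)
    (E F A B : Module.End ℂ V) : Prop where
  ne_zero : t ≠ 0
  pow_ne_one : ∀ n : ℕ, 0 < n → t ^ n ≠ 1
  coeff_ne_zero : d ≠ 0
  comm : ∀ x, A (B x) = B (A x)
  iSup_left : ⨆ μ, A.eigenspace μ = ⊤
  iSup_right : ⨆ μ, B.eigenspace μ = ⊤
  inj_left : ∀ x, A x = 0 → x = 0
  inj_right : ∀ x, B x = 0 → x = 0
  left_raise : ∀ x, A (E x) = t • E (A x)
  right_raise : ∀ x, B (E x) = t⁻¹ • E (B x)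
  left_lower : ∀ x, A (F x) = t⁻¹ • F (A x)
  right_lower : ∀ x, B (F x) = t • F (B x)
  raise_lower : ∀ x, E (F x) = F (E x) + (d * (t - 1)) • (A x - B x)

namespace IsWeightTuple

variable {V : Type*} [AddCommGroup V] [Module ℂ V] {t d : ℂ} {E F A B : Module.End ℂ V}

theorem symm (h : IsWeightTuple t d E F A B) : IsWeightTuple t d F E B A where
  ne_zero := h.ne_zero
  pow_ne_one := h.pow_ne_one
  coeff_ne_zero := h.coeff_ne_zero
  comm x := (h.comm x).symm
  iSup_left := h.iSup_right
  iSup_right := h.iSup_left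
  inj_left := h.inj_right
  inj_right := h.inj_left
  left_raise := h.right_lower
  right_raise := h.left_lower
  left_lower := h.right_raise
  right_lower := h.left_raise
  raise_lower x := by rw [h.raise_lower]; module

theorem isNilpotent_raise [FiniteDimensional ℂ V] (h : IsWeightTuple t d E F A B) :
    IsNilpotent E :=
  isNilpotent_of_eigenvalue_shift h.ne_zero h.pow_ne_one h.inj_left h.iSup_left h.left_raise

/-- The Casimir operator `F E + d (t A + B)`. -/
def casimir (t d : ℂ) (E F A B : Module.End ℂ V) : Module.End ℂ V :=
  F * E + d • (t • A + B)

theorem casimir_apply (x : V) :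
    casimir t d E F A B x = F (E x) + d • (t • A x + B x) := rfl

theorem commute_casimir_raise (h : IsWeightTuple t d E F A B) :
    Commute (casimir t d E F A B) E := by
  refine LinearMap.ext fun x ↦ ?_
  simp only [Module.End.mul_apply, casimir_apply, map_add, map_smul, h.raise_lower, h.left_raise,
    h.right_raise]
  have := h.ne_zero
  match_scalars <;> field_simp <;> ring

theorem commute_casimir_lower (h : IsWeightTuple t d E F A B) :
    Commute (casimir t d E F A B) F := by
  refine LinearMap.ext fun x ↦ ?_
  simp only [Module.End.mul_apply, casimir_apply, map_add, map_smul, map_sub, h.raise_lower,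
    h.left_lower, h.right_lower]
  have := h.ne_zero
  match_scalars <;> field_simp <;> ring

theorem left_pow_raise (h : IsWeightTuple t d E F A B) {a : ℂ} {v : V} (hv : A v = a • v)
    (k : ℕ) : A ((E ^ k) v) = (t ^ k * a) • (E ^ k) v := by
  induction k with
  | zero => simpa using hv
  | succ k ih =>
    rw [pow_succ', Module.End.mul_apply, h.left_raise, ih, map_smul, smul_smul]
    congr 1
    ring

theorem right_pow_raise (h : IsWeightTuple t d E F A B) {b : ℂ} {v : V} (hv : B v = b • v)
    (k : ℕ) : B ((E ^ k) v) = ((t ^ k)⁻¹ * b) • (E ^ k) v := by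
  induction k with
  | zero => simpa using hv
  | succ k ih =>
    rw [pow_succ', Module.End.mul_apply, h.right_raise, ih, map_smul, smul_smul]
    congr 1
    have := h.ne_zero
    field_simp
    ring

/-- If `D` acts nilpotently on `x`, then `x` is not an eigenvector with nonzero eigenvalue. -/
theorem eq_zero_of_pow_apply_eq_zero {D : Module.End ℂ V} {x : V} {s : ℂ} (hs : s ≠ 0) {n : ℕ}
    (hn : (D ^ n) x = 0) (hx : D x = s • x) : x = 0 := by
  have hpow : ∀ k : ℕ, (D ^ k) x = s ^ k • x := by
    intro k
    induction k with
    | zero => simp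
    | succ k ih => rw [pow_succ', Module.End.mul_apply, ih, map_smul, hx, smul_smul, pow_succ]
  rw [hpow] at hn
  exact (smul_eq_zero.1 hn).resolve_left (pow_ne_zero n hs)

/-- A weight vector on which the Casimir operator acts, up to nilpotents, as on a highest weight
vector of that weight is a highest weight vector. -/
theorem raise_eq_zero [FiniteDimensional ℂ V] (h : IsWeightTuple t d E F A B) {a b : ℂ} {v : V}
    (ha : A v = a • v) (hb : B v = b • v) {n : ℕ}
    (hn : ((casimir t d E F A B - (d * (t * a + b)) • 1) ^ n) v = 0) : E v = 0 := by
  set D := casimir t d E F A B - (d * (t * a + b)) • 1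
  have ht0 := h.ne_zero
  have hd0 := h.coeff_ne_zero
  have hDx : ∀ x, D x = F (E x) + d • (t • A x + B x) - (d * (t * a + b)) • x := fun x ↦ rfl
  have hDE : Commute D E :=
    h.commute_casimir_raise.sub_left ((Commute.one_left E).smul_left _)
  have hDF : Commute D F :=
    h.commute_casimir_lower.sub_left ((Commute.one_left F).smul_left _)
  have hEn (k : ℕ) : (D ^ n) ((E ^ k) v) = 0 := by
    rw [← Module.End.mul_apply, (hDE.pow_pow n k).eq, Module.End.mul_apply, hn, map_zero]
  have hFn (k : ℕ) : (D ^ n) ((F ^ k) v) = 0 := by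
    rw [← Module.End.mul_apply, (hDF.pow_pow n k).eq, Module.End.mul_apply, hn, map_zero]
  by_cases hdom : ∃ k : ℕ, 0 < k ∧ b = t ^ (k + 1) * a
  · obtain ⟨k, -, hk⟩ := hdom
    suffices hv : v = 0 by rw [hv, map_zero]
    by_contra hv0
    have ha0 : a ≠ 0 := fun h0 ↦ hv0 (h.inj_left v (by rw [ha, h0, zero_smul]))
    have step : ∀ j : ℕ, (F ^ (j + 1)) v = 0 → (F ^ j) v = 0 := by
      intro j hj
      rw [pow_succ', Module.End.mul_apply] at hj
      have hE := h.raise_lower ((F ^ j) v)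
      have hA := h.symm.right_pow_raise ha j
      have hB := h.symm.left_pow_raise hb j
      rw [hj, map_zero, hA, hB] at hE
      have hs : -(d * (1 - (t ^ (j + 1))⁻¹) * (t * a - t ^ (j + 1) * b)) ≠ 0 := by
        refine neg_ne_zero.2 (mul_ne_zero (mul_ne_zero hd0 ?_) ?_)
        · rw [sub_ne_zero]
          exact fun h1 ↦ h.pow_ne_one (j + 1) (by omega) (inv_eq_one.1 h1.symm)
        · rw [show t * a - t ^ (j + 1) * b = t * a * (1 - t ^ (j + k + 1)) by rw [hk]; ring]
          exact mul_ne_zero (mul_ne_zero ht0 ha0)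
            (sub_ne_zero.2 fun h1 ↦ h.pow_ne_one _ (by omega) h1.symm)
      refine eq_zero_of_pow_apply_eq_zero hs (hFn j) ?_
      rw [hDx, hA, hB]
      rw [eq_neg_of_add_eq_zero_left hE.symm]
      match_scalars
      field_simp
      ring
    have hall : ∀ j : ℕ, (F ^ j) v = 0 → v = 0 := by
      intro j
      induction j with
      | zero => simp
      | succ j ih => exact fun hj ↦ ih (step j hj)
    obtain ⟨N, hN⟩ := h.symm.isNilpotent_raise
    exact hv0 (hall N (by rw [hN, LinearMap.zero_apply]))
  · push Not at hdom
    have step : ∀ j : ℕ, (E ^ (j + 2)) v = 0 → (E ^ (j + 1)) v = 0 := by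
      intro j hj
      rw [pow_succ', Module.End.mul_apply] at hj
      have hA := h.left_pow_raise ha (j + 1)
      have hB := h.right_pow_raise hb (j + 1)
      have hs : d * (t ^ (j + 1) - 1) * (t * a - (t ^ (j + 1))⁻¹ * b) ≠ 0 := by
        refine mul_ne_zero (mul_ne_zero hd0 (sub_ne_zero.2 (h.pow_ne_one _ (by omega)))) ?_
        rw [sub_ne_zero]
        intro h1
        refine hdom (j + 1) (by omega) ?_
        field_simp at h1
        rw [← h1]
        ring
      refine eq_zero_of_pow_apply_eq_zero hs (hEn (j + 1)) ?_
      rw [hDx, hA, hB, hj, map_zero]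
      match_scalars
      field_simp
      ring
    have hall : ∀ j : ℕ, (E ^ (j + 1)) v = 0 → E v = 0 := by
      intro j
      induction j with
      | zero => simp
      | succ j ih => exact fun hj ↦ ih (step j hj)
    obtain ⟨N, hN⟩ := h.isNilpotent_raise
    exact hall N (by rw [pow_succ', hN, mul_zero, LinearMap.zero_apply])

theorem ker_raise_sup_range_lower [FiniteDimensional ℂ V] (h : IsWeightTuple t d E F A B) :
    LinearMap.ker E ⊔ LinearMap.range F = ⊤ := by
  have ht0 := h.ne_zero
  have hAT : Commute A (F * E) := by
    refine LinearMap.ext fun x ↦ ?_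
    simp only [Module.End.mul_apply, h.left_lower, h.left_raise, map_smul, smul_smul,
      inv_mul_cancel₀ ht0, one_smul]
  have hBT : Commute B (F * E) := by
    refine LinearMap.ext fun x ↦ ?_
    simp only [Module.End.mul_apply, h.right_lower, h.right_raise, map_smul, smul_smul,
      mul_inv_cancel₀ ht0, one_smul]
  obtain ⟨n, hn, hn1⟩ := ((F * E).eventually_isCompl_ker_pow_range_pow.and
    (Filter.eventually_ge_atTop 1)).exists
  rw [← top_le_iff, ← hn.sup_eq_top]
  refine sup_le ?_ (le_sup_of_le_right ?_)
  · have hker {C : Module.End ℂ V} (hC : Commute C (F * E)) :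
        ∀ x ∈ LinearMap.ker ((F * E) ^ n), C x ∈ LinearMap.ker ((F * E) ^ n) := by
      intro x hx
      rw [LinearMap.mem_ker] at hx ⊢
      rw [← Module.End.mul_apply, ← (hC.pow_right n).eq, Module.End.mul_apply, hx, map_zero]
    refine le_of_forall_joint_eigenvector h.comm h.iSup_left h.iSup_right (hker hAT) (hker hBT) ?_
    intro v hv a b ha hb
    refine Submodule.mem_sup_left (LinearMap.mem_ker.2 (h.raise_eq_zero ha hb (n := n) ?_))
    set D := casimir t d E F A B - (d * (t * a + b)) • 1
    have hDT : Commute D (F * E) :=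
      (h.commute_casimir_lower.mul_right h.commute_casimir_raise).sub_left
        ((Commute.one_left _).smul_left _)
    have hDv : D v = (F * E) v := by
      change F (E v) + d • (t • A v + B v) - (d * (t * a + b)) • v = F (E v)
      rw [ha, hb]
      module
    have hpow : ∀ k : ℕ, (D ^ k) v = ((F * E) ^ k) v := by
      intro k
      induction k with
      | zero => simp
      | succ k ih =>
        rw [pow_succ', Module.End.mul_apply, ih, ← Module.End.mul_apply, (hDT.pow_right k).eq,
          Module.End.mul_apply, hDv, ← Module.End.mul_apply, ← pow_succ]
    rw [hpow]
    exact hv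
  · rintro _ ⟨x, rfl⟩
    obtain ⟨k, rfl⟩ := Nat.exists_eq_add_of_le' hn1
    exact ⟨E (((F * E) ^ k) x), by rw [pow_succ']; rfl⟩

theorem disjoint_ker_raise_range_lower [FiniteDimensional ℂ V]
    (h : IsWeightTuple t d E F A B) : Disjoint (LinearMap.ker E) (LinearMap.range F) := by
  have h1 := h.ker_raise_sup_range_lower
  have h2 := h.symm.ker_raise_sup_range_lower
  have d1 := Submodule.finrank_sup_add_finrank_inf_eq (LinearMap.ker E) (LinearMap.range F)
  have d2 := Submodule.finrank_sup_add_finrank_inf_eq (LinearMap.ker F) (LinearMap.range E)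
  have r1 := LinearMap.finrank_range_add_finrank_ker E
  have r2 := LinearMap.finrank_range_add_finrank_ker F
  rw [h1, finrank_top] at d1
  rw [h2, finrank_top] at d2
  rw [disjoint_iff, ← Submodule.finrank_eq_zero (R := ℂ)]
  omega

end IsWeightTuple

/-- A `ℂ`-subspace stable under the generators is a submodule. -/
def submoduleOfStable {q : ℂ} {r : FA} {V : Type*} [AddCommGroup V] [Module ℂ V]
    [Module (Uq q r) V] [IsScalarTower ℂ (Uq q r) V] (S : Submodule ℂ V)
    (h : ∀ g : Gen, ∀ x ∈ S, RingQuot.mkAlgHom ℂ (URel q r) (FreeAlgebra.ι ℂ g) • x ∈ S) :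
    Submodule (Uq q r) V where
  __ := S
  smul_mem' u x hx := by
    obtain ⟨y, rfl⟩ := RingQuot.mkAlgHom_surjective ℂ (URel q r) u
    change _ • x ∈ S
    replace hx : x ∈ S := hx
    induction y using FreeAlgebra.induction generalizing x with
    | grade0 c =>
      rw [AlgHom.commutes, algebraMap_smul]
      exact S.smul_mem c hx
    | grade1 g => exact h g x hx
    | mul a b iha ihb =>
      rw [map_mul, mul_smul]
      exact iha _ (ihb x hx)
    | add a b iha ihb =>
      rw [map_add, add_smul]
      exact S.add_mem (iha x hx) (ihb x hx)

theorem mem_submoduleOfStable {q : ℂ} {r : FA} {V : Type*} [AddCommGroup V] [Module ℂ V]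
    [Module (Uq q r) V] [IsScalarTower ℂ (Uq q r) V] {S : Submodule ℂ V}
    {h : ∀ g : Gen, ∀ x ∈ S, RingQuot.mkAlgHom ℂ (URel q r) (FreeAlgebra.ι ℂ g) • x ∈ S} {x : V} :
    x ∈ submoduleOfStable S h ↔ x ∈ S := Iff.rfl

section Relations

variable (q : ℂ) (r : FA)

theorem uK_mul_uKi : uK q r * uKi q r = 1 := by
  simpa [uK, uKi] using RingQuot.mkAlgHom_rel ℂ (URel.KKi (q := q) (r := r))

theorem uKi_mul_uK : uKi q r * uK q r = 1 := by
  simpa [uK, uKi] using RingQuot.mkAlgHom_rel ℂ (URel.KiK (q := q) (r := r))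

theorem uH_mul_uHi : uH q r * uHi q r = 1 := by
  simpa [uH, uHi] using RingQuot.mkAlgHom_rel ℂ (URel.HHi (q := q) (r := r))

theorem uHi_mul_uH : uHi q r * uH q r = 1 := by
  simpa [uH, uHi] using RingQuot.mkAlgHom_rel ℂ (URel.HiH (q := q) (r := r))

theorem uK_mul_uH : uK q r * uH q r = uH q r * uK q r := by
  simpa [uK, uH] using RingQuot.mkAlgHom_rel ℂ (URel.KH (q := q) (r := r))

theorem uK_mul_uE : uK q r * uE q r = q ^ 2 • (uE q r * uK q r) := by
  simpa [uK, uE] using RingQuot.mkAlgHom_rel ℂ (URel.KE (q := q) (r := r))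

theorem uK_mul_uF : uK q r * uF q r = (q ^ 2)⁻¹ • (uF q r * uK q r) := by
  simpa [uK, uF] using RingQuot.mkAlgHom_rel ℂ (URel.KF (q := q) (r := r))

theorem uH_mul_uE : uH q r * uE q r = (q ^ 2)⁻¹ • (uE q r * uH q r) := by
  simpa [uH, uE] using RingQuot.mkAlgHom_rel ℂ (URel.HE (q := q) (r := r))

theorem uH_mul_uF : uH q r * uF q r = q ^ 2 • (uF q r * uH q r) := by
  simpa [uH, uF] using RingQuot.mkAlgHom_rel ℂ (URel.HF (q := q) (r := r))

theorem uE_mul_uF_sub (m : ℕ) :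
    uE q (fm q m) * uF q (fm q m) - uF q (fm q m) * uE q (fm q m) =
      (q - q⁻¹)⁻¹ • (uK q (fm q m) ^ m - uH q (fm q m) ^ m) := by
  have h := RingQuot.mkAlgHom_rel ℂ (URel.EF (q := q) (r := fm q m))
  rw [map_sub, map_mul, map_mul] at h
  refine h.trans ?_
  conv_lhs => arg 2; unfold fm
  rw [map_smul, map_sub, map_pow, map_pow]
  rfl

end Relations

theorem pow_mul_of_mul_eq_smul_mul {U : Type*} [Ring U] [Algebra ℂ U] {k e : U} {s : ℂ}
    (h : k * e = s • (e * k)) (n : ℕ) : k ^ n * e = s ^ n • (e * k ^ n) := by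
  induction n with
  | zero => simp
  | succ n ih =>
    rw [pow_succ, mul_assoc, h, mul_smul_comm, ← mul_assoc, ih, smul_mul_assoc, smul_smul,
      mul_assoc, ← pow_succ', ← pow_succ]

theorem eq_zero_of_smul_eq_zero_of_mul_eq_one {U V : Type*} [Ring U] [AddCommGroup V] [Module U V]
    {u u' : U} (h : u' * u = 1) {x : V} (hx : u • x = 0) : x = 0 := by
  rw [← one_smul U x, ← h, mul_smul, hx, smul_zero]

/-- The operator by which an element of the algebra acts. -/
abbrev actionHom (q : ℂ) (r : FA) (V : Type*) [AddCommGroup V] [Module ℂ V] [Module (Uq q r) V]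
    [IsScalarTower ℂ (Uq q r) V] : Uq q r →ₐ[ℂ] Module.End ℂ V := Algebra.lsmul ℂ ℂ V

section Weight

variable {q : ℂ} {m : ℕ} {V : Type*} [AddCommGroup V] [Module ℂ V] [Module (Um q m) V]
  [IsScalarTower ℂ (Um q m) V]

theorem ActsDiag.iSup_eigenspace_eq_top {u : Um q m} (h : ActsDiag q m V u) :
    ⨆ μ, (actionHom q (fm q m) V u).eigenspace μ = ⊤ := by
  rw [← top_le_iff]
  intro v _
  induction h v using AddSubgroup.closure_induction with
  | mem w hw =>
    obtain ⟨a, ha⟩ := hw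
    rw [algebraMap_smul] at ha
    exact Submodule.mem_iSup_of_mem a (Module.End.mem_eigenspace_iff.2 ha)
  | zero => exact Submodule.zero_mem _
  | add x y _ _ hx hy => exact Submodule.add_mem _ (hx trivial) (hy trivial)
  | neg x _ hx => exact Submodule.neg_mem _ (hx trivial)

theorem ActsDiag.pow {u : Um q m} (h : ActsDiag q m V u) (n : ℕ) : ActsDiag q m V (u ^ n) := by
  intro v
  refine AddSubgroup.closure_mono ?_ (h v)
  rintro w ⟨a, ha⟩
  refine ⟨a ^ n, ?_⟩
  rw [algebraMap_smul] at ha ⊢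
  induction n with
  | zero => simp
  | succ n ih => rw [pow_succ', mul_smul, ih, smul_comm, ha, smul_smul, pow_succ]

theorem isWeightTuple_action (hq0 : q ≠ 0) (hq : ∀ n : ℕ, 0 < n → q ^ n ≠ 1) (hm : 1 ≤ m)
    (hK : ActsDiag q m V (uK q (fm q m))) (hH : ActsDiag q m V (uH q (fm q m))) :
    IsWeightTuple ((q ^ 2) ^ m) ((q - q⁻¹)⁻¹ * ((q ^ 2) ^ m - 1)⁻¹)
      (actionHom q (fm q m) V (uE q (fm q m))) (actionHom q (fm q m) V (uF q (fm q m)))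
      (actionHom q (fm q m) V (uK q (fm q m) ^ m))
      (actionHom q (fm q m) V (uH q (fm q m) ^ m)) := by
  have ht1 : (q ^ 2) ^ m - 1 ≠ 0 := by
    rw [sub_ne_zero, ← pow_mul]
    exact hq _ (by omega)
  have hqi : q - q⁻¹ ≠ 0 := by
    rw [sub_ne_zero]
    intro h
    refine hq 2 (by omega) ?_
    rw [pow_two]
    nth_rewrite 2 [h]
    exact mul_inv_cancel₀ hq0
  have rel {k e : Um q m} {s : ℂ} (h : k * e = s • (e * k)) (x : V) :
      k ^ m • e • x = s ^ m • e • k ^ m • x := by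
    rw [← mul_smul, pow_mul_of_mul_eq_smul_mul h, smul_assoc, mul_smul]
  refine ⟨pow_ne_zero _ (pow_ne_zero _ hq0), fun n hn ↦ ?_, ?_, fun x ↦ ?_,
    (hK.pow m).iSup_eigenspace_eq_top, (hH.pow m).iSup_eigenspace_eq_top, fun x hx ↦ ?_,
    fun x hx ↦ ?_, fun x ↦ rel (uK_mul_uE q _) x, fun x ↦ ?_, fun x ↦ ?_,
    fun x ↦ rel (uH_mul_uF q _) x, fun x ↦ ?_⟩
  · rw [← pow_mul, ← pow_mul]
    exact hq _ (by positivity)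
  · exact mul_ne_zero (inv_ne_zero hqi) (inv_ne_zero ht1)
  · change uK q (fm q m) ^ m • uH q (fm q m) ^ m • x = uH q (fm q m) ^ m • uK q (fm q m) ^ m • x
    rw [← mul_smul, ← mul_smul, ((show Commute _ _ from uK_mul_uH q (fm q m)).pow_pow m m).eq]
  · refine eq_zero_of_smul_eq_zero_of_mul_eq_one (u' := uKi q (fm q m) ^ m) ?_ hx
    have hc : Commute (uKi q (fm q m)) (uK q (fm q m)) :=
      (uKi_mul_uK q _).trans (uK_mul_uKi q _).symm
    rw [← hc.mul_pow, uKi_mul_uK, one_pow]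
  · refine eq_zero_of_smul_eq_zero_of_mul_eq_one (u' := uHi q (fm q m) ^ m) ?_ hx
    have hc : Commute (uHi q (fm q m)) (uH q (fm q m)) :=
      (uHi_mul_uH q _).trans (uH_mul_uHi q _).symm
    rw [← hc.mul_pow, uHi_mul_uH, one_pow]
  · rw [← inv_pow]
    exact rel (uH_mul_uE q _) x
  · rw [← inv_pow]
    exact rel (uK_mul_uF q _) x
  · have h := congrArg (· • x) (uE_mul_uF_sub q m)
    simp only [sub_smul, mul_smul, smul_assoc] at h
    rw [mul_assoc, inv_mul_cancel₀ ht1, mul_one, ← sub_eq_iff_eq_add']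
    exact h

/-- The subspace spanned by the translates of a highest weight vector by powers of `F` is stable
under the generators. -/
theorem generator_smul_mem_span {v : V} {a b : ℂ} (hE : uE q (fm q m) • v = 0)
    (ha : uK q (fm q m) • v = a • v) (hb : uH q (fm q m) • v = b • v) (g : Gen) (x : V)
    (hx : x ∈ Submodule.span ℂ (Set.range fun i : ℕ ↦ uF q (fm q m) ^ i • v)) :
    RingQuot.mkAlgHom ℂ (URel q (fm q m)) (FreeAlgebra.ι ℂ g) • x ∈
      Submodule.span ℂ (Set.range fun i : ℕ ↦ uF q (fm q m) ^ i • v) := by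
  set S := Submodule.span ℂ (Set.range fun i : ℕ ↦ uF q (fm q m) ^ i • v) with hS
  have hbasis (i : ℕ) : uF q (fm q m) ^ i • v ∈ S := Submodule.subset_span ⟨i, rfl⟩
  have red {u : Um q m} (h : ∀ i : ℕ, u • uF q (fm q m) ^ i • v ∈ S) : ∀ x ∈ S, u • x ∈ S := by
    intro x hx
    have hle : S ≤ S.comap (actionHom q (fm q m) V u) := by
      rw [hS, Submodule.span_le]
      rintro _ ⟨i, rfl⟩
      exact h i
    exact hle hx
  have shift {k : Um q m} {s c : ℂ}
      (hk : k * uF q (fm q m) = s • (uF q (fm q m) * k)) (hc : k • v = c • v) (i : ℕ) :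
      k • uF q (fm q m) ^ i • v = (s ^ i * c) • uF q (fm q m) ^ i • v := by
    induction i with
    | zero => simpa using hc
    | succ i ih =>
      rw [pow_succ', mul_smul, ← mul_smul k, hk, smul_assoc, mul_smul, ih, smul_comm _ (s ^ i * c),
        smul_smul, pow_succ', mul_assoc]
  have inverse {k k' : Um q m} {c : ℂ} {w : V} (hkk : k' * k = 1) (hk : k • w = c • w)
      (hw : w ∈ S) : k' • w ∈ S := by
    have h1 : w = c • k' • w := by rw [smul_comm, ← hk, ← mul_smul, hkk, one_smul]
    by_cases hc : c = 0
    · rw [h1, hc, zero_smul, smul_zero]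
      exact S.zero_mem
    · have h2 : k' • w = c⁻¹ • w := by
        conv_rhs => rw [h1]
        rw [smul_smul, inv_mul_cancel₀ hc, one_smul]
      rw [h2]
      exact S.smul_mem _ hw
  have hKS := shift (uK_mul_uF q _) ha
  have hHS := shift (uH_mul_uF q _) hb
  have hF : ∀ x ∈ S, uF q (fm q m) • x ∈ S := red fun i ↦ by
    rw [← mul_smul, ← pow_succ']
    exact hbasis (i + 1)
  have hK : ∀ x ∈ S, uK q (fm q m) • x ∈ S := red fun i ↦ by
    rw [hKS]
    exact S.smul_mem _ (hbasis i)
  have hH : ∀ x ∈ S, uH q (fm q m) • x ∈ S := red fun i ↦ by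
    rw [hHS]
    exact S.smul_mem _ (hbasis i)
  have hpow {u : Um q m} (h : ∀ x ∈ S, u • x ∈ S) (n : ℕ) : ∀ x ∈ S, u ^ n • x ∈ S := by
    induction n with
    | zero => simp
    | succ n ih =>
      intro x hx
      rw [pow_succ, mul_smul]
      exact ih _ (h x hx)
  cases g with
  | F => exact hF x hx
  | K => exact hK x hx
  | H => exact hH x hx
  | Kinv => exact red (fun i ↦ inverse (uKi_mul_uK q _) (hKS i) (hbasis i)) x hx
  | Hinv => exact red (fun i ↦ inverse (uHi_mul_uH q _) (hHS i) (hbasis i)) x hx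
  | E =>
    refine red (u := uE q (fm q m)) (fun i ↦ ?_) x hx
    induction i with
    | zero => rw [pow_zero, one_smul, hE]; exact S.zero_mem
    | succ i ih =>
      rw [pow_succ', mul_smul, ← mul_smul, eq_add_of_sub_eq (uE_mul_uF_sub q m), add_smul,
        smul_assoc, sub_smul, mul_smul]
      exact S.add_mem (S.smul_mem _ (S.sub_mem (hpow hK m _ (hbasis i)) (hpow hH m _ (hbasis i))))
        (hF _ ih)

/-- A highest weight vector generates a simple submodule. -/
theorem isSimpleModule_span_singleton [FiniteDimensional ℂ V] {t d : ℂ} {A B : Module.End ℂ V}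
    (h : IsWeightTuple t d (actionHom q (fm q m) V (uE q (fm q m)))
      (actionHom q (fm q m) V (uF q (fm q m))) A B) {v : V} (hv : v ≠ 0) {a b : ℂ}
    (hE : uE q (fm q m) • v = 0) (ha : uK q (fm q m) • v = a • v)
    (hb : uH q (fm q m) • v = b • v) : IsSimpleModule (Um q m) (Submodule.span (Um q m) {v}) := by
  rw [isSimpleModule_iff_isAtom]
  have hgen : ∀ x ∈ Submodule.span (Um q m) {v}, ∃ c : ℂ, ∃ y : V,
      x = c • v + uF q (fm q m) • y := by
    intro x hx
    have hle : Submodule.span (Um q m) {v} ≤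
        submoduleOfStable _ (generator_smul_mem_span hE ha hb) := by
      rw [Submodule.span_singleton_le_iff_mem, mem_submoduleOfStable]
      exact Submodule.subset_span ⟨0, by simp⟩
    have hx' := mem_submoduleOfStable.1 (hle hx)
    clear hx
    induction hx' using Submodule.span_induction with
    | mem x hx =>
      obtain ⟨i, rfl⟩ := hx
      cases i with
      | zero => exact ⟨1, 0, by simp⟩
      | succ i => exact ⟨0, uF q (fm q m) ^ i • v, by simp [pow_succ', mul_smul]⟩
    | zero => exact ⟨0, 0, by simp⟩
    | add x y _ _ hx hy =>
      obtain ⟨c, x', rfl⟩ := hx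
      obtain ⟨e, y', rfl⟩ := hy
      exact ⟨c + e, x' + y', by rw [add_smul, smul_add]; abel⟩
    | smul s x _ hx =>
      obtain ⟨c, x', rfl⟩ := hx
      exact ⟨s * c, s • x', by rw [smul_add, smul_smul, smul_comm s]⟩
  refine ⟨fun h0 ↦ hv (Submodule.span_singleton_eq_bot.1 h0), fun M hM ↦ ?_⟩
  by_contra hM0
  refine hM.not_ge ?_
  rw [Submodule.span_singleton_le_iff_mem]
  obtain ⟨w, hwM, hw0⟩ := Submodule.exists_mem_ne_zero_of_ne_bot hM0
  obtain ⟨N, hN⟩ := h.isNilpotent_raise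
  have hNw : uE q (fm q m) ^ N • w = 0 := by
    have := LinearMap.congr_fun hN w
    rwa [← map_pow] at this
  classical
  have hex : ∃ n : ℕ, uE q (fm q m) ^ n • w = 0 := ⟨N, hNw⟩
  obtain ⟨k, hk⟩ := Nat.exists_eq_succ_of_ne_zero (n := Nat.find hex) fun h0 ↦
    hw0 (by simpa [h0] using Nat.find_spec hex)
  have hx0 : uE q (fm q m) ^ k • w ≠ 0 := Nat.find_min hex (by omega)
  have hxE : uE q (fm q m) • uE q (fm q m) ^ k • w = 0 := by
    rw [← mul_smul, ← pow_succ', ← Nat.succ_eq_add_one, ← hk]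
    exact Nat.find_spec hex
  have hxM : uE q (fm q m) ^ k • w ∈ M := M.smul_mem _ hwM
  generalize uE q (fm q m) ^ k • w = x at hx0 hxE hxM
  obtain ⟨c, y, hxy⟩ := hgen x (hM.le hxM)
  have hz : x - c • v = 0 := by
    refine Submodule.disjoint_def.1 h.disjoint_ker_raise_range_lower _ ?_ ⟨y, ?_⟩
    · change uE q (fm q m) • (x - c • v) = 0
      rw [smul_sub, hxE, smul_comm, hE, smul_zero, sub_zero]
    · change uF q (fm q m) • y = _
      rw [hxy, add_sub_cancel_left]
  rw [sub_eq_zero] at hz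
  have hc : c ≠ 0 := fun hc ↦ hx0 (by rw [hz, hc, zero_smul])
  have hvx : v = algebraMap ℂ (Um q m) c⁻¹ • x := by
    rw [algebraMap_smul, hz, smul_smul, inv_mul_cancel₀ hc, one_smul]
  rw [hvx]
  exact M.smul_mem _ hxM

end Weight

/-- Every finite-dimensional weight module over `U = U_q(f_m(K,H))`
(a finite-dimensional module on which both `K` and `H` act semisimply) is completely
reducible, i.e. a direct sum of simple `U`-submodules. -/
theorem stmt9 (q : ℂ) (hq0 : q ≠ 0) (hq : ∀ n : ℕ, 0 < n → q ^ n ≠ 1)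
    (m : ℕ) (hm : 1 ≤ m)
    (V : Type*) [AddCommGroup V] [Module ℂ V] [Module (Um q m) V]
    [IsScalarTower ℂ (Um q m) V] [FiniteDimensional ℂ V]
    (hK : ActsDiag q m V (uK q (fm q m)))
    (hH : ActsDiag q m V (uH q (fm q m))) :
    IsSemisimpleModule (Um q m) V := by
  have h := isWeightTuple_action hq0 hq hm hK hH
  refine IsSemisimpleModule.of_sSup_simples_eq_top ?_
  set W := sSup {M : Submodule (Um q m) V | IsSimpleModule (Um q m) M}
  have hker : LinearMap.ker (actionHom q (fm q m) V (uE q (fm q m))) ≤ W.restrictScalars ℂ := by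
    have hstab {k : Um q m} {s : ℂ} (hk : k * uE q (fm q m) = s • (uE q (fm q m) * k))
        (hs : s ≠ 0) (x : V) (hx : uE q (fm q m) • x = 0) : uE q (fm q m) • k • x = 0 := by
      have h0 : s • uE q (fm q m) • k • x = 0 := by
        rw [← mul_smul, ← smul_assoc, ← hk, mul_smul, hx, smul_zero]
      exact (smul_eq_zero.1 h0).resolve_left hs
    refine le_of_forall_joint_eigenvector (A := actionHom q (fm q m) V (uK q (fm q m)))
      (B := actionHom q (fm q m) V (uH q (fm q m))) (fun x ↦ ?_) hK.iSup_eigenspace_eq_top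
      hH.iSup_eigenspace_eq_top (hstab (uK_mul_uE q _) (pow_ne_zero 2 hq0))
      (hstab (uH_mul_uE q _) (inv_ne_zero (pow_ne_zero 2 hq0))) fun x hx a b ha hb ↦ ?_
    · change uK q (fm q m) • uH q (fm q m) • x = uH q (fm q m) • uK q (fm q m) • x
      rw [← mul_smul, ← mul_smul, uK_mul_uH]
    · by_cases hx0 : x = 0
      · rw [hx0]
        exact Submodule.zero_mem _
      · have hle : Submodule.span (Um q m) {x} ≤ W :=
          le_sSup (isSimpleModule_span_singleton h hx0 hx ha hb)
        exact hle (Submodule.mem_span_singleton_self x)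
  have hfilt : ∀ n : ℕ, ∀ x : V, ∃ w ∈ W, ∃ y : V, x = w + uF q (fm q m) ^ n • y := by
    intro n
    induction n with
    | zero => exact fun x ↦ ⟨0, W.zero_mem, x, by simp⟩
    | succ n ih =>
      intro x
      obtain ⟨w, hw, y, rfl⟩ := ih x
      have hy : y ∈ LinearMap.ker (actionHom q (fm q m) V (uE q (fm q m))) ⊔
          LinearMap.range (actionHom q (fm q m) V (uF q (fm q m))) :=
        h.ker_raise_sup_range_lower ▸ Submodule.mem_top
      obtain ⟨y₁, hy₁, _, ⟨y₂, rfl⟩, rfl⟩ := Submodule.mem_sup.1 hy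
      refine ⟨w + uF q (fm q m) ^ n • y₁, W.add_mem hw (W.smul_mem _ (hker hy₁)), y₂, ?_⟩
      rw [smul_add, ← add_assoc, pow_succ, mul_smul]
      rfl
  obtain ⟨N, hN⟩ := h.symm.isNilpotent_raise
  rw [eq_top_iff]
  intro x _
  obtain ⟨w, hw, y, rfl⟩ := hfilt N x
  have hy : uF q (fm q m) ^ N • y = 0 := by
    have := LinearMap.congr_fun hN y
    rwa [← map_pow] at this
  rwa [hy, add_zero]
end

section
/- The center Z(U) of U equals the subalgebra of U generated by Ω, KH, and (KH)⁻¹ = K⁻¹H⁻¹. Moreover, the ℂ-algebra homomorphism from ℂ[x][y, y⁻¹] (polynomials in x with Laurent polynomial coefficients in y) to U sending x ↦ Ω and y ↦ KH is injective with image Z(U); i.e. Z(U) is isomorphic to the localization ℂ[Ω, KH]_{(KH)} of a polynomial ring in two variables. -/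
/-- The Casimir element `Ω = FE + (q^{2m}K^m + H^m)/((q^{2m} - 1)(q - q⁻¹))`. -/
noncomputable def Om (q : ℂ) (m : ℕ) : Um q m :=
  uF q (fm q m) * uE q (fm q m) +
    ((q ^ (2 * m) - 1) * (q - q⁻¹))⁻¹ •
      (q ^ (2 * m) • uK q (fm q m) ^ m + uH q (fm q m) ^ m)

noncomputable section

open LaurentPolynomial

/-- The defining relations of `U_q(f_m(K,H))` for elements `E`, `F` and units `K`, `H` of an
algebra. -/
structure UqRelations (q : ℂ) (m : ℕ) {A : Type*} [Ring A] [Algebra ℂ A]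
    (E F : A) (K H : Aˣ) : Prop where
  KH : (K * H : A) = H * K
  KE : (K * E : A) = q ^ 2 • (E * K)
  KF : (K * F : A) = (q ^ 2)⁻¹ • (F * K)
  HE : (H * E : A) = (q ^ 2)⁻¹ • (E * H)
  HF : (H * F : A) = q ^ 2 • (F * H)
  EF : E * F - F * E = (q - q⁻¹)⁻¹ • ((K : A) ^ m - (H : A) ^ m)

/-- An element skew-commuting with a unit skew-commutes with its integer powers. -/
lemma Units.zpow_mul_of_skew {A : Type*} [Ring A] [Algebra ℂ A] {x : A} {u : Aˣ} {c : ℂ}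
    (hc : c ≠ 0) (h : (u * x : A) = c • (x * u)) (n : ℤ) :
    ((u ^ n : Aˣ) * x : A) = c ^ n • (x * (u ^ n : Aˣ)) := by
  have hinv : ((u⁻¹ : Aˣ) * x : A) = c⁻¹ • (x * (u⁻¹ : Aˣ)) := by
    rw [eq_inv_smul_iff₀ hc, ← Units.mul_left_inj u, ← Units.mul_right_inj u]
    simp [← mul_assoc, h, mul_assoc x]
  induction n with
  | zero => simp
  | succ n ih =>
    rw [zpow_add_one, zpow_add_one₀ hc, Units.val_mul, mul_assoc, h, mul_smul_comm, ← mul_assoc,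
      ih, smul_mul_assoc, smul_smul, mul_assoc, mul_comm c]
  | pred n ih =>
    rw [zpow_sub_one, zpow_sub_one₀ hc, Units.val_mul, mul_assoc, hinv, mul_smul_comm,
      ← mul_assoc, ih, smul_mul_assoc, smul_smul, mul_assoc, mul_comm c⁻¹]

lemma Units.pow_mul_of_skew {A : Type*} [Ring A] [Algebra ℂ A] {x : A} {u : Aˣ} {c : ℂ}
    (hc : c ≠ 0) (h : (u * x : A) = c • (x * u)) (n : ℕ) :
    ((u : A) ^ n * x : A) = c ^ n • (x * (u : A) ^ n) := by
  simpa using Units.zpow_mul_of_skew hc h n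

/-- The scalar in front of the toral part of the Casimir element. -/
def casimirScalar (q : ℂ) (m : ℕ) : ℂ := ((q ^ (2 * m) - 1) * (q - q⁻¹))⁻¹

/-- The Casimir element attached to elements satisfying the relations of `U_q(f_m(K,H))`. -/
def casimir (q : ℂ) (m : ℕ) {A : Type*} [Ring A] [Algebra ℂ A] (E F : A) (K H : Aˣ) : A :=
  F * E + casimirScalar q m • (q ^ (2 * m) • (K : A) ^ m + (H : A) ^ m)

namespace UqRelations

variable {q : ℂ} {m : ℕ} {A : Type*} [Ring A] [Algebra ℂ A] {E F : A} {K H : Aˣ}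

lemma scalar_mul (hm : q ^ (2 * m) ≠ 1) :
    casimirScalar q m * (q ^ (2 * m) - 1) = (q - q⁻¹)⁻¹ := by
  have : q ^ (2 * m) - 1 ≠ 0 := sub_ne_zero.2 hm
  rw [casimirScalar, mul_inv, mul_comm, mul_inv_cancel_left₀ this]

lemma commute_KH (h : UqRelations q m E F K H) : Commute (K : A) H := h.KH

lemma commute_KH_E (hq : q ≠ 0) (h : UqRelations q m E F K H) : Commute ((K * H : Aˣ) : A) E := by
  have h2 : q ^ 2 ≠ 0 := pow_ne_zero _ hq
  change _ = _
  rw [Units.val_mul, mul_assoc, h.HE, mul_smul_comm, ← mul_assoc, h.KE, smul_mul_assoc,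
    smul_smul, inv_mul_cancel₀ h2, one_smul, mul_assoc]

lemma commute_KH_F (hq : q ≠ 0) (h : UqRelations q m E F K H) : Commute ((K * H : Aˣ) : A) F := by
  have h2 : q ^ 2 ≠ 0 := pow_ne_zero _ hq
  change _ = _
  rw [Units.val_mul, mul_assoc, h.HF, mul_smul_comm, ← mul_assoc, h.KF, smul_mul_assoc,
    smul_smul, mul_inv_cancel₀ h2, one_smul, mul_assoc]

lemma commute_KH_K (h : UqRelations q m E F K H) : Commute ((K * H : Aˣ) : A) K := by
  rw [Units.val_mul]
  exact (Commute.refl _).mul_left h.commute_KH.symm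

lemma commute_KH_H (h : UqRelations q m E F K H) : Commute ((K * H : Aˣ) : A) H := by
  rw [Units.val_mul]
  exact h.commute_KH.mul_left (Commute.refl _)

lemma casimir_eq (hm : q ^ (2 * m) ≠ 1) (h : UqRelations q m E F K H) :
    casimir q m E F K H =
      E * F + casimirScalar q m • ((K : A) ^ m + q ^ (2 * m) • (H : A) ^ m) := by
  have := h.EF
  rw [← scalar_mul hm, sub_eq_iff_eq_add] at this
  rw [casimir, this]
  module

lemma commute_casimir_K (hq : q ≠ 0) (h : UqRelations q m E F K H) :
    Commute (casimir q m E F K H) K := by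
  have h2 : q ^ 2 ≠ 0 := pow_ne_zero _ hq
  have hFE : Commute (F * E) (K : A) := by
    refine Commute.symm ?_
    change _ = _
    rw [← mul_assoc, h.KF, smul_mul_assoc, mul_assoc, h.KE, mul_smul_comm, smul_smul,
      inv_mul_cancel₀ h2, one_smul, mul_assoc]
  refine hFE.add_left (Commute.smul_left (Commute.add_left (Commute.smul_left ?_ _) ?_) _)
  · exact (Commute.refl _).pow_left _
  · exact h.commute_KH.symm.pow_left _

lemma commute_casimir_H (hq : q ≠ 0) (h : UqRelations q m E F K H) :
    Commute (casimir q m E F K H) H := by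
  have h2 : q ^ 2 ≠ 0 := pow_ne_zero _ hq
  have hFE : Commute (F * E) (H : A) := by
    refine Commute.symm ?_
    change _ = _
    rw [← mul_assoc, h.HF, smul_mul_assoc, mul_assoc, h.HE, mul_smul_comm, smul_smul,
      mul_inv_cancel₀ h2, one_smul, mul_assoc]
  refine hFE.add_left (Commute.smul_left (Commute.add_left (Commute.smul_left ?_ _) ?_) _)
  · exact h.commute_KH.pow_left _
  · exact (Commute.refl _).pow_left _

lemma commute_casimir_E (hq : q ≠ 0) (hm : q ^ (2 * m) ≠ 1) (h : UqRelations q m E F K H) :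
    Commute (casimir q m E F K H) E := by
  have h2 : q ^ 2 ≠ 0 := pow_ne_zero _ hq
  have hK := Units.pow_mul_of_skew h2 h.KE m
  have hH := Units.pow_mul_of_skew (inv_ne_zero h2) h.HE m
  rw [inv_pow, ← pow_mul] at hH
  rw [← pow_mul] at hK
  have h3 : q ^ (2 * m) ≠ 0 := pow_ne_zero _ hq
  change _ = _
  conv_rhs => rw [h.casimir_eq hm]
  conv_lhs => rw [h.casimir_eq hm]
  have hEF := h.EF
  rw [← scalar_mul hm, sub_eq_iff_eq_add'] at hEF
  have hFE : F * E = E * F - (casimirScalar q m * (q ^ (2 * m) - 1)) •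
      ((K : A) ^ m - (H : A) ^ m) := by rw [hEF]; abel
  simp only [add_mul, mul_add, smul_mul_assoc, mul_smul_comm, hK, hH, mul_assoc, hFE, mul_sub,
    smul_smul, mul_inv_cancel₀ h3, smul_add, smul_sub]
  module

lemma commute_casimir_F (hq : q ≠ 0) (hm : q ^ (2 * m) ≠ 1) (h : UqRelations q m E F K H) :
    Commute (casimir q m E F K H) F := by
  have h2 : q ^ 2 ≠ 0 := pow_ne_zero _ hq
  have hK := Units.pow_mul_of_skew (inv_ne_zero h2) h.KF m
  have hH := Units.pow_mul_of_skew h2 h.HF m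
  rw [inv_pow, ← pow_mul] at hK
  rw [← pow_mul] at hH
  have h3 : q ^ (2 * m) ≠ 0 := pow_ne_zero _ hq
  change _ = _
  have hEF := h.EF
  rw [← scalar_mul hm, sub_eq_iff_eq_add'] at hEF
  simp only [casimir, add_mul, mul_add, smul_mul_assoc, mul_smul_comm, hK, hH, mul_assoc, hEF,
    mul_sub, smul_smul, mul_inv_cancel₀ h3, smul_add, smul_sub]
  module

end UqRelations

/-- The canonical map from Laurent polynomials over `B` to an algebra determined by its
restriction to `B` and by a unit commuting with the image of `B`. -/
def laurentLift {B A : Type*} [CommRing B] [Algebra ℂ B] [Ring A] [Algebra ℂ A]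
    (f : B →ₐ[ℂ] A) (u : Aˣ) (h : ∀ b, Commute (f b) u) : B[T;T⁻¹] →ₐ[ℂ] A :=
  AddMonoidAlgebra.liftNCAlgHom f ((Units.coeHom A).comp (zpowersHom Aˣ u)) fun b n => by
    simpa [zpowersHom] using (h b).units_zpow_right n.toAdd

section laurentLift

variable {B A : Type*} [CommRing B] [Algebra ℂ B] [Ring A] [Algebra ℂ A]
    {f : B →ₐ[ℂ] A} {u : Aˣ} {h : ∀ b, Commute (f b) u}

lemma laurentLift_C_mul_T (b : B) (n : ℤ) :
    laurentLift f u h (C b * T n) = f b * (u ^ n : Aˣ) := by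
  rw [← single_eq_C_mul_T, laurentLift, AddMonoidAlgebra.coe_liftNCAlgHom,
    AddMonoidAlgebra.liftNC_single]
  simp [zpowersHom]

lemma laurentLift_C (b : B) : laurentLift f u h (C b) = f b := by
  simpa using laurentLift_C_mul_T (h := h) b 0

lemma laurentLift_T (n : ℤ) : laurentLift f u h (T n) = (u ^ n : Aˣ) := by
  simpa using laurentLift_C_mul_T (h := h) 1 n

end laurentLift

/-- The canonical map `ℂ[y, y⁻¹][x] → A` determined by a unit and an element commuting with it. -/
def polyLaurentLift {A : Type*} [Ring A] [Algebra ℂ A] (x : A) (y : Aˣ) (h : Commute x y) :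
    Polynomial ℂ[T;T⁻¹] →ₐ[ℂ] A :=
  let f := laurentLift (Algebra.ofId ℂ A) y fun b => Algebra.commute_algebraMap_left b _
  have hf : ∀ a, Commute (f a) x := fun a => by
    induction a using LaurentPolynomial.induction_on' with
    | add a b ha hb => rw [map_add]; exact ha.add_left hb
    | C_mul_T n c =>
      rw [show f (C c * T n) = algebraMap ℂ A c * (y ^ n : Aˣ) from laurentLift_C_mul_T c n]
      exact (Algebra.commute_algebraMap_left c x).mul_left (h.units_zpow_right n).symm
  { Polynomial.eval₂RingHom' f.toRingHom x hf with
    commutes' := fun c => by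
      simpa [Polynomial.algebraMap_apply] using f.commutes c }

section polyLaurentLift

variable {A : Type*} [Ring A] [Algebra ℂ A] {x : A} {y : Aˣ} {h : Commute x y}

lemma polyLaurentLift_X : polyLaurentLift x y h Polynomial.X = x := by
  simp [polyLaurentLift]

lemma polyLaurentLift_C_T (n : ℤ) :
    polyLaurentLift x y h (Polynomial.C (T n)) = (y ^ n : Aˣ) := by
  simpa [polyLaurentLift] using laurentLift_T n

lemma polyLaurentLift_mem {S : Subalgebra ℂ A} (hx : x ∈ S) (hy : (y : A) ∈ S)
    (hy' : ((y⁻¹ : Aˣ) : A) ∈ S) (p : Polynomial ℂ[T;T⁻¹]) : polyLaurentLift x y h p ∈ S := by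
  have hzpow (n : ℤ) : ((y ^ n : Aˣ) : A) ∈ S := by
    cases n with
    | ofNat n => simpa using S.pow_mem hy n
    | negSucc n => simpa [← inv_pow] using S.pow_mem hy' (n + 1)
  have hC (a : ℂ[T;T⁻¹]) : polyLaurentLift x y h (Polynomial.C a) ∈ S := by
    induction a using LaurentPolynomial.induction_on' with
    | add a b ha hb => rw [map_add, map_add]; exact S.add_mem ha hb
    | C_mul_T n c =>
      rw [map_mul, map_mul, polyLaurentLift_C_T]
      refine S.mul_mem ?_ (hzpow n)
      have : Polynomial.C (C c) = algebraMap ℂ (Polynomial ℂ[T;T⁻¹]) c := rfl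
      rw [this, AlgHom.commutes]
      exact S.algebraMap_mem c
  induction p using Polynomial.induction_on' with
  | add p r hp hr => rw [map_add]; exact S.add_mem hp hr
  | monomial n a =>
    rw [← Polynomial.C_mul_X_pow_eq_monomial, map_mul, map_pow, polyLaurentLift_X]
    exact S.mul_mem (hC a) (S.pow_mem hx n)

end polyLaurentLift

lemma laurent_algHom_ext {B A : Type*} [CommRing B] [Algebra ℂ B] [Semiring A]
    [Algebra ℂ A] {f g : B[T;T⁻¹] →ₐ[ℂ] A} (hC : ∀ b, f (C b) = g (C b)) (hT : f (T 1) = g (T 1)) :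
    f = g := by
  have hpow : (f : B[T;T⁻¹] →* A).comp (AddMonoidAlgebra.of B ℤ) =
      (g : B[T;T⁻¹] →* A).comp (AddMonoidAlgebra.of B ℤ) := MonoidHom.ext_mint hT
  refine AlgHom.ext fun p => ?_
  induction p using LaurentPolynomial.induction_on' with
  | add a b ha hb => rw [map_add, map_add, ha, hb]
  | C_mul_T n b =>
    rw [map_mul, map_mul, hC]
    congr 1
    exact DFunLike.congr_fun hpow (Multiplicative.ofAdd n)

/-- The unit `T n` of the ring of Laurent polynomials. -/
@[simps]
def unitT {B : Type*} [CommRing B] (n : ℤ) : B[T;T⁻¹]ˣ where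
  val := T n
  inv := T (-n)
  val_inv := by rw [← T_add, add_neg_cancel, T_zero]
  inv_val := by rw [← T_add, neg_add_cancel, T_zero]

lemma unitT_zpow {B : Type*} [CommRing B] (n : ℤ) :
    (unitT 1 : B[T;T⁻¹]ˣ) ^ n = unitT n := by
  ext1
  have := DFunLike.congr_fun (MonoidHom.ext_mint
    (f := (Units.coeHom _).comp (zpowersHom B[T;T⁻¹]ˣ (unitT 1)))
    (g := AddMonoidAlgebra.of B ℤ) (by simp [zpowersHom])) (Multiplicative.ofAdd n)
  simpa [zpowersHom] using this

section scale

variable {B : Type*} [CommRing B] [Algebra ℂ B]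

/-- The endomorphism of the ring of Laurent polynomials scaling the variable by `c`. -/
def scale (c : ℂˣ) : B[T;T⁻¹] →ₐ[ℂ] B[T;T⁻¹] :=
  laurentLift (Algebra.algHom ℂ B B[T;T⁻¹])
    (Units.map (algebraMap ℂ B[T;T⁻¹]).toMonoidHom c * unitT 1) fun _ => Commute.all _ _

lemma scale_C_mul_T (c : ℂˣ) (b : B) (n : ℤ) :
    scale c (C b * T n) = (c : ℂ) ^ n • (C b * T n) := by
  rw [scale, laurentLift_C_mul_T, mul_zpow, unitT_zpow, ← map_zpow, Units.val_mul,
    Algebra.smul_def, Units.coe_map]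
  simp only [RingHom.toMonoidHom_eq_coe, MonoidHom.coe_coe, Units.val_zpow_eq_zpow_val, val_unitT]
  rw [← mul_assoc, mul_comm (Algebra.algHom ℂ B B[T;T⁻¹] b), mul_assoc]
  rfl

lemma scale_T (c : ℂˣ) (n : ℤ) : scale c (T n : B[T;T⁻¹]) = (c : ℂ) ^ n • T n := by
  simpa using scale_C_mul_T c (1 : B) n

lemma scale_C (c : ℂˣ) (b : B) : scale c (C b) = C b := by
  simpa using scale_C_mul_T c b 0

lemma scale_scale (c d : ℂˣ) (r : B[T;T⁻¹]) : scale c (scale d r) = scale (c * d) r := by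
  induction r using LaurentPolynomial.induction_on' with
  | add a b ha hb => simp only [map_add, ha, hb]
  | C_mul_T n b =>
    rw [scale_C_mul_T, map_smul, scale_C_mul_T, scale_C_mul_T, smul_smul, Units.val_mul, mul_zpow,
      mul_comm]

lemma scale_one (r : B[T;T⁻¹]) : scale 1 r = r := by
  induction r using LaurentPolynomial.induction_on' with
  | add a b ha hb => simp only [map_add, ha, hb]
  | C_mul_T n b => simp [scale_C_mul_T]

lemma coeff_scale (c : ℂˣ) (r : B[T;T⁻¹]) (n : ℤ) :
    (scale c r).coeff n = (c : ℂ) ^ n • r.coeff n := by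
  induction r using LaurentPolynomial.induction_on' with
  | add a b ha hb => simp [ha, hb]
  | C_mul_T k b =>
    rw [scale_C_mul_T, ← single_eq_C_mul_T, AddMonoidAlgebra.coeff_smul, Finsupp.smul_apply,
      AddMonoidAlgebra.coeff_single]
    by_cases hk : k = n
    · rw [hk]
    · simp [Finsupp.single_eq_of_ne' hk]

lemma eq_C_of_scale_eq {c : ℂˣ} (hc : ∀ n : ℤ, n ≠ 0 → c ^ n ≠ 1) {r : B[T;T⁻¹]}
    (hr : scale c r = r) : r = C (r.coeff 0) := by
  ext n
  rw [C_apply]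
  split_ifs with hn
  · rw [hn]
  · have h1 := coeff_scale c r n
    rw [hr] at h1
    have h2 : ((c : ℂ) ^ n - 1) • r.coeff n = 0 := by rw [sub_smul, one_smul, ← h1, sub_self]
    have h3 : (c : ℂ) ^ n - 1 ≠ 0 := by
      rw [sub_ne_zero]
      exact fun h => hc n hn (Units.ext (by simpa using h))
    exact (smul_eq_zero_iff_right h3).1 h2

lemma laurentLift_skew {A : Type*} [Ring A] [Algebra ℂ A]
    {f : B →ₐ[ℂ] A} {u : Aˣ} {h : ∀ b, Commute (f b) u} {x : A} {c : ℂˣ}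
    (hx : ∀ b, Commute (f b) x) (hu : (u * x : A) = (c : ℂ) • (x * u)) (r : B[T;T⁻¹]) :
    x * laurentLift f u h r = laurentLift f u h (scale c⁻¹ r) * x := by
  induction r using LaurentPolynomial.induction_on' with
  | add a b ha hb => simp only [map_add, mul_add, add_mul, ha, hb]
  | C_mul_T n b =>
    have hn := Units.zpow_mul_of_skew c.ne_zero hu n
    rw [scale_C_mul_T, map_smul, laurentLift_C_mul_T, ← mul_assoc, ← (hx b).eq, smul_mul_assoc,
      mul_assoc, mul_assoc, hn, mul_smul_comm, smul_smul, ← mul_zpow]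
    simp

end scale

/-- The subalgebra generated by the Casimir element and `(KH)^{±1}`, as an abstract ring. -/
abbrev CenterRing : Type := Polynomial ℂ[T;T⁻¹]

/-- The coefficient ring of the normal form: Laurent polynomials in `K` over `CenterRing`. -/
abbrev Coef : Type := CenterRing[T;T⁻¹]

/-- The unit of `Coef` representing `H = (KH)K⁻¹`. -/
def coefH : Coefˣ := Units.map (C.comp Polynomial.C).toMonoidHom (unitT 1) * unitT (-1)

/-- The element of `Coef` representing `FE`. -/
def coefFE (q : ℂ) (m : ℕ) : Coef :=
  C Polynomial.X - casimirScalar q m • (q ^ (2 * m) • T 1 ^ m + (coefH : Coef) ^ m)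

lemma coefH_val : (coefH : Coef) = C (Polynomial.C (T 1)) * T (-1) := rfl

lemma coefH_mul_T : (coefH : Coef) * T 1 = C (Polynomial.C (T 1)) := by
  rw [coefH_val, mul_assoc, ← T_add, neg_add_cancel, T_zero, mul_one]

lemma coefH_pow (m : ℕ) : (coefH : Coef) ^ m = C (Polynomial.C (T m)) * T (-m) := by
  have hmul (a b : Coef) : (a * b) ^ m = a ^ m * b ^ m := mul_pow a b m
  rw [coefH_val, hmul, ← map_pow, ← map_pow, T_pow, T_pow]
  simp

lemma scale_coefH (c : ℂˣ) : scale c (coefH : Coef) = (c : ℂ)⁻¹ • coefH := by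
  rw [coefH_val, scale_C_mul_T]
  simp

lemma coeff_C_mul_T_of_ne {B : Type*} [CommRing B] (b : B) {k n : ℤ} (h : k ≠ n) :
    (C b * T k).coeff n = 0 := by
  rw [← single_eq_C_mul_T, AddMonoidAlgebra.coeff_single, Finsupp.single_eq_of_ne' h]

lemma coefFE_ne_zero (q : ℂ) {m : ℕ} (hm : m ≠ 0) : coefFE q m ≠ 0 := by
  intro h
  have h0 := congrArg (fun r : Coef => r.coeff 0) h
  have hm' : -(m : ℤ) ≠ 0 := by simpa using hm
  rw [coefFE, coefH_pow, T_pow] at h0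
  simp [hm, coeff_C_mul_T_of_ne _ hm'] at h0

section LeftRegular

variable {R : Type*} [CommRing R] [Algebra ℂ R] (σ : R ≃ₐ[ℂ] R) (g : R)

/-- The operator by which `E` acts on the free module with basis indexed by `ℤ`. -/
def opE : Module.End ℂ (ℤ →₀ R) :=
  Finsupp.lsum ℂ fun n => Finsupp.lsingle (n + 1) ∘ₗ σ.symm.toLinearMap

/-- The operator by which `F` acts on the free module with basis indexed by `ℤ`, given the
element `g` by which `FE` acts. -/
def opF : Module.End ℂ (ℤ →₀ R) :=
  Finsupp.lsum ℂ fun n => Finsupp.lsingle (n - 1) ∘ₗ LinearMap.mulLeft ℂ g ∘ₗ σ.toLinearMap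

/-- The action of a unit of the coefficient ring by multiplication. -/
def opUnit (u : Rˣ) : (Module.End ℂ (ℤ →₀ R))ˣ :=
  Units.map (Algebra.lsmul ℂ ℂ (ℤ →₀ R)).toRingHom.toMonoidHom u

lemma opE_single (n : ℤ) (r : R) :
    opE σ (Finsupp.single n r) = Finsupp.single (n + 1) (σ.symm r) := by
  simp [opE]

lemma opF_single (n : ℤ) (r : R) :
    opF σ g (Finsupp.single n r) = Finsupp.single (n - 1) (g * σ r) := by
  simp [opF]

lemma opUnit_val (u : Rˣ) :
    (opUnit u : Module.End ℂ (ℤ →₀ R)) = Algebra.lsmul ℂ ℂ (ℤ →₀ R) (u : R) := rfl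

lemma lsmul_single (r : R) (n : ℤ) (s : R) :
    Algebra.lsmul ℂ ℂ (ℤ →₀ R) r (Finsupp.single n s) = Finsupp.single n (r * s) := by
  simp

lemma opE_mul_lsmul (s : R) :
    opE σ * Algebra.lsmul ℂ ℂ (ℤ →₀ R) s = Algebra.lsmul ℂ ℂ (ℤ →₀ R) (σ.symm s) * opE σ :=
  Finsupp.lhom_ext fun n r => by
    simp only [Module.End.mul_apply, lsmul_single, opE_single, map_mul]

lemma opF_mul_lsmul (s : R) :
    opF σ g * Algebra.lsmul ℂ ℂ (ℤ →₀ R) s = Algebra.lsmul ℂ ℂ (ℤ →₀ R) (σ s) * opF σ g :=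
  Finsupp.lhom_ext fun n r => by
    simp only [Module.End.mul_apply, lsmul_single, opF_single, map_mul, mul_left_comm]

lemma opF_mul_opE : opF σ g * opE σ = Algebra.lsmul ℂ ℂ (ℤ →₀ R) g :=
  Finsupp.lhom_ext fun n r => by
    simp only [Module.End.mul_apply, lsmul_single, opF_single, opE_single,
      AlgEquiv.apply_symm_apply, add_sub_cancel_right]

lemma opE_mul_opF : opE σ * opF σ g = Algebra.lsmul ℂ ℂ (ℤ →₀ R) (σ.symm g) :=
  Finsupp.lhom_ext fun n r => by
    simp only [Module.End.mul_apply, lsmul_single, opF_single, opE_single, map_mul,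
      AlgEquiv.symm_apply_apply, sub_add_cancel]

variable {σ}

lemma opUnit_mul_opE {c : ℂ} {u : Rˣ} (hu : σ u = c • (u : R)) :
    (opUnit u * opE σ : Module.End ℂ (ℤ →₀ R)) =
      c • (opE σ * (opUnit u : Module.End ℂ (ℤ →₀ R))) := by
  have hu' : (u : R) = c • σ.symm u := by
    rw [← map_smul, ← hu, AlgEquiv.symm_apply_apply]
  rw [opUnit_val, opE_mul_lsmul]
  conv_lhs => rw [hu', map_smul, smul_mul_assoc]

lemma opUnit_mul_opF {c : ℂ} (hc : c ≠ 0) {u : Rˣ} (hu : σ u = c • (u : R)) :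
    (opUnit u * opF σ g : Module.End ℂ (ℤ →₀ R)) =
      c⁻¹ • (opF σ g * (opUnit u : Module.End ℂ (ℤ →₀ R))) := by
  rw [opUnit_val, opF_mul_lsmul, hu, map_smul, smul_mul_assoc, inv_smul_smul₀ hc]

/-- The operators on the free module satisfy the defining relations. -/
lemma uqRelations_op {q : ℂ} (hq : q ≠ 0) {m : ℕ} (hm : q ^ (2 * m) ≠ 1) {K H : Rˣ} {x : R}
    (hK : σ K = q ^ 2 • (K : R)) (hH : σ H = (q ^ 2)⁻¹ • (H : R)) (hx : σ x = x)
    (hg : g = x - casimirScalar q m • (q ^ (2 * m) • (K : R) ^ m + (H : R) ^ m)) :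
    UqRelations q m (opE σ) (opF σ g) (opUnit K) (opUnit H) where
  KH := by
    rw [opUnit_val, opUnit_val, ← map_mul, ← map_mul, mul_comm]
  KE := opUnit_mul_opE hK
  KF := opUnit_mul_opF g (pow_ne_zero _ hq) hK
  HE := opUnit_mul_opE hH
  HF := by
    simpa only [inv_inv] using opUnit_mul_opF g (inv_ne_zero (pow_ne_zero _ hq)) hH
  EF := by
    have hsub (a b : R) : Algebra.lsmul ℂ ℂ (ℤ →₀ R) a - Algebra.lsmul ℂ ℂ (ℤ →₀ R) b =
        Algebra.lsmul ℂ ℂ (ℤ →₀ R) (a - b) := (map_sub (Algebra.lsmul ℂ ℂ (ℤ →₀ R)) a b).symm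
    rw [opE_mul_opF, opF_mul_opE, opUnit_val, opUnit_val, ← map_pow, ← map_pow, hsub, hsub,
      ← map_smul]
    congr 1
    have h3 : q ^ (2 * m) ≠ 0 := pow_ne_zero _ hq
    have hKm : σ.symm ((K : R) ^ m) = (q ^ (2 * m))⁻¹ • (K : R) ^ m := by
      rw [AlgEquiv.symm_apply_eq, map_smul, map_pow, hK, smul_pow, ← pow_mul, inv_smul_smul₀ h3]
    have hHm : σ.symm ((H : R) ^ m) = q ^ (2 * m) • (H : R) ^ m := by
      rw [AlgEquiv.symm_apply_eq, map_smul, map_pow, hH, smul_pow, inv_pow, ← pow_mul,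
        smul_inv_smul₀ h3]
    have hx' : σ.symm x = x := by rw [AlgEquiv.symm_apply_eq, hx]
    rw [hg, map_sub, map_smul, map_add, map_smul, hKm, hHm, hx', smul_smul,
      mul_inv_cancel₀ h3, ← UqRelations.scalar_mul hm]
    module

end LeftRegular

section NormalForm

/-- `E ^ n` for `n ≥ 0` and `F ^ (-n)` for `n ≤ 0`. -/
def ladder {A : Type*} [Ring A] (E F : A) (n : ℤ) : A := E ^ n.toNat * F ^ (-n).toNat

lemma ladder_natCast {A : Type*} [Ring A] (E F : A) (n : ℕ) :
    ladder E F n = E ^ n := by simp [ladder]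

lemma ladder_neg_natCast {A : Type*} [Ring A] (E F : A) (n : ℕ) :
    ladder E F (-n) = F ^ n := by simp [ladder]

lemma ladder_zero {A : Type*} [Ring A] (E F : A) : ladder E F 0 = 1 := by simp [ladder]

lemma ladder_one {A : Type*} [Ring A] (E F : A) : ladder E F 1 = E := by simpa using ladder_natCast E F 1

variable {R A : Type*} [CommRing R] [Algebra ℂ R] [Ring A] [Algebra ℂ A]

/-- The map sending a family `(rₙ)` of coefficients to `∑ rₙ Wₙ`, where `Wₙ` is the ladder. -/
def normalForm (i : R →ₐ[ℂ] A) (E F : A) : (ℤ →₀ R) →ₗ[ℂ] A :=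
  Finsupp.lsum ℂ fun n => LinearMap.mulRight ℂ (ladder E F n) ∘ₗ i.toLinearMap

variable {i : R →ₐ[ℂ] A} {E F : A}

lemma normalForm_single (n : ℤ) (r : R) :
    normalForm i E F (Finsupp.single n r) = i r * ladder E F n := by
  simp [normalForm]

lemma mul_ladder_E {s : R} (hEF : E * F = i s) (n : ℤ) :
    ∃ r, E * ladder E F n = i r * ladder E F (n + 1) := by
  obtain ⟨n, rfl | rfl⟩ := n.eq_nat_or_neg
  · refine ⟨1, ?_⟩
    rw [ladder_natCast, ← Nat.cast_succ, ladder_natCast, map_one, one_mul, pow_succ']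
  · cases n with
    | zero => exact ⟨1, by simp [ladder_zero, ladder_one]⟩
    | succ n =>
      refine ⟨s, ?_⟩
      rw [ladder_neg_natCast, pow_succ', ← mul_assoc, hEF, ← ladder_neg_natCast E F n]
      congr 2
      push_cast
      ring

lemma mul_ladder_F {s : R} (hFE : F * E = i s) (n : ℤ) :
    ∃ r, F * ladder E F n = i r * ladder E F (n - 1) := by
  obtain ⟨n, rfl | rfl⟩ := n.eq_nat_or_neg
  · cases n with
    | zero =>
      refine ⟨1, ?_⟩
      have := ladder_neg_natCast E F 1
      simp_all [ladder_zero]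
    | succ n =>
      refine ⟨s, ?_⟩
      rw [ladder_natCast, pow_succ', ← mul_assoc, hFE, ← ladder_natCast E F n]
      congr 2
      push_cast
      ring
  · refine ⟨1, ?_⟩
    have : -(n : ℤ) - 1 = -((n + 1 : ℕ) : ℤ) := by push_cast; ring
    rw [ladder_neg_natCast, this, ladder_neg_natCast, map_one, one_mul, pow_succ']

/-- Left multiplication by an element `a` preserves the span of the normal forms as soon as it
maps each normal monomial into it. -/
lemma mul_mem_range_normalForm {a : A}
    (h : ∀ n r, a * (i r * ladder E F n) ∈ LinearMap.range (normalForm i E F)) (f : ℤ →₀ R) :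
    a * normalForm i E F f ∈ LinearMap.range (normalForm i E F) := by
  induction f using Finsupp.induction_linear with
  | zero => simp
  | add f g hf hg => rw [map_add, mul_add]; exact add_mem hf hg
  | single n r => rw [normalForm_single]; exact h n r

lemma normalForm_surjective {σ : R ≃ₐ[ℂ] R} {s t : R} (hEF : E * F = i s) (hFE : F * E = i t)
    (hE : ∀ r, E * i r = i (σ.symm r) * E) (hF : ∀ r, F * i r = i (σ r) * F)
    (hgen : ∀ S : Subalgebra ℂ A, E ∈ S → F ∈ S → i.range ≤ S → S = ⊤) :
    Function.Surjective (normalForm i E F) := by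
  let N := LinearMap.range (normalForm i E F)
  let S : Subalgebra ℂ A :=
    { carrier := {a | ∀ b ∈ N, a * b ∈ N}
      mul_mem' := fun ha ha' b hb => by rw [mul_assoc]; exact ha _ (ha' _ hb)
      add_mem' := fun ha ha' b hb => by rw [add_mul]; exact add_mem (ha _ hb) (ha' _ hb)
      algebraMap_mem' := fun c b hb => by
        rw [← Algebra.smul_def]; exact N.smul_mem c hb }
  have hS : S = ⊤ := by
    refine hgen S ?_ ?_ ?_
    · rintro _ ⟨f, rfl⟩
      refine mul_mem_range_normalForm (fun n r => ?_) f
      obtain ⟨r', hr'⟩ := mul_ladder_E hEF n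
      exact ⟨Finsupp.single (n + 1) (σ.symm r * r'), by
        rw [normalForm_single, ← mul_assoc, hE, mul_assoc, hr', map_mul, mul_assoc]⟩
    · rintro _ ⟨f, rfl⟩
      refine mul_mem_range_normalForm (fun n r => ?_) f
      obtain ⟨r', hr'⟩ := mul_ladder_F hFE n
      exact ⟨Finsupp.single (n - 1) (σ r * r'), by
        rw [normalForm_single, ← mul_assoc, hF, mul_assoc, hr', map_mul, mul_assoc]⟩
    · rintro _ ⟨s, rfl⟩ _ ⟨f, rfl⟩
      refine mul_mem_range_normalForm (fun n r => ?_) f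
      exact ⟨Finsupp.single n (s * r), by
        rw [normalForm_single, map_mul, mul_assoc]; rfl⟩
  intro a
  have ha : a ∈ S := hS ▸ Algebra.mem_top
  have h1 : (1 : A) ∈ N := ⟨Finsupp.single 0 1, by simp [normalForm_single, ladder_zero]⟩
  rw [← mul_one a]
  exact ha 1 h1

lemma normalForm_injective [IsDomain R] {σ : R ≃ₐ[ℂ] R} {g : R} (hg : g ≠ 0)
    (ρ : A →ₐ[ℂ] Module.End ℂ (ℤ →₀ R)) (hE : ρ E = opE σ) (hF : ρ F = opF σ g)
    (hi : ∀ r, ρ (i r) = Algebra.lsmul ℂ ℂ (ℤ →₀ R) r) :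
    Function.Injective (normalForm i E F) := by
  have hEn (n : ℕ) : (opE σ ^ n) (Finsupp.single 0 1) = Finsupp.single (n : ℤ) (1 : R) := by
    induction n with
    | zero => simp
    | succ n ih => rw [pow_succ', Module.End.mul_apply, ih, opE_single]; simp
  have hFn (n : ℕ) : ∃ s : R, s ≠ 0 ∧
      (opF σ g ^ n) (Finsupp.single 0 1) = Finsupp.single (-n : ℤ) s := by
    induction n with
    | zero => exact ⟨1, one_ne_zero, by simp⟩
    | succ n ih =>
      obtain ⟨s, hs, h⟩ := ih
      refine ⟨g * σ s, mul_ne_zero hg (by simpa using hs), ?_⟩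
      rw [pow_succ', Module.End.mul_apply, h, opF_single]
      congr 1
      push_cast
      ring
  have hW (n : ℤ) : ∃ s : R, s ≠ 0 ∧
      ρ (ladder E F n) (Finsupp.single 0 1) = Finsupp.single n s := by
    obtain ⟨n, rfl | rfl⟩ := n.eq_nat_or_neg
    · exact ⟨1, one_ne_zero, by rw [ladder_natCast, map_pow, hE, hEn]⟩
    · simpa only [ladder_neg_natCast, map_pow, hF] using hFn n
  choose s hs0 hs using hW
  have key (f : ℤ →₀ R) (n : ℤ) :
      (ρ (normalForm i E F f) (Finsupp.single 0 1)) n = f n * s n := by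
    induction f using Finsupp.induction_linear with
    | zero => simp
    | add f g hf hg => simp [hf, hg, add_mul]
    | single k r =>
      rw [normalForm_single, map_mul, hi, Module.End.mul_apply, hs, lsmul_single]
      by_cases hk : k = n
      · simp [hk]
      · simp [Finsupp.single_eq_of_ne' hk]
  intro f f' h
  ext n
  refine mul_right_cancel₀ (hs0 n) ?_
  rw [← key, ← key, h]

/-- An element commuting with a unit `K` that acts on the ladder with distinct weights lies in
the coefficient ring. -/
lemma exists_of_commute_K (hinj : Function.Injective (normalForm i E F))
    (hsurj : Function.Surjective (normalForm i E F)) {u : Rˣ} {K : Aˣ} (hu : i u = K) {c : ℂ}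
    (hc : ∀ n : ℤ, n ≠ 0 → c ^ n ≠ 1) (hKE : (K * E : A) = c • (E * K))
    (hKF : (K * F : A) = c⁻¹ • (F * K)) {z : A} (hz : Commute z K) : ∃ r, z = i r := by
  obtain ⟨f, rfl⟩ := hsurj z
  have hpow {a : A} {d : ℂ} (h : (K * a : A) = d • (a * K)) (n : ℕ) :
      (K * a ^ n : A) = d ^ n • (a ^ n * K) := by
    induction n with
    | zero => simp
    | succ n ih =>
      rw [pow_succ, ← mul_assoc, ih, smul_mul_assoc, mul_assoc, h, mul_smul_comm, smul_smul,
        mul_assoc, pow_succ]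
  have hW (n : ℤ) : (K * ladder E F n : A) = c ^ n • (ladder E F n * K) := by
    obtain ⟨n, rfl | rfl⟩ := n.eq_nat_or_neg
    · rw [ladder_natCast, hpow hKE, zpow_natCast]
    · rw [ladder_neg_natCast, hpow hKF, zpow_neg, zpow_natCast, inv_pow]
  let D : (ℤ →₀ R) →ₗ[ℂ] (ℤ →₀ R) :=
    Finsupp.lsum ℂ fun n => (c ^ n) • (Finsupp.lsingle n ∘ₗ LinearMap.id)
  have hDcoeff (f : ℤ →₀ R) (n : ℤ) : D f n = c ^ n • f n := by
    induction f using Finsupp.induction_linear with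
    | zero => simp
    | add f g hf hg => simp [hf, hg]
    | single k r =>
      by_cases hk : k = n
      · simp [D, hk]
      · simp [D, Finsupp.single_eq_of_ne' hk]
  have hD (f : ℤ →₀ R) : K * normalForm i E F f = normalForm i E F (D f) * K := by
    induction f using Finsupp.induction_linear with
    | zero => simp
    | add f g hf hg => simp only [map_add, mul_add, add_mul, hf, hg]
    | single n r =>
      have : D (Finsupp.single n r) = c ^ n • Finsupp.single n r := by simp [D]
      rw [this, map_smul, normalForm_single, ← mul_assoc, ← hu, ← map_mul, mul_comm, map_mul,
        mul_assoc, hu, hW, mul_smul_comm, smul_mul_assoc, mul_assoc]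
  have hDf : D f = f := hinj <| (Units.mul_left_inj K).1 <| by rw [← hD, hz.eq]
  have hf : f = Finsupp.single 0 (f 0) := by
    ext n
    by_cases hn : n = 0
    · simp [hn]
    · rw [Finsupp.single_eq_of_ne hn]
      have h1 := hDcoeff f n
      rw [hDf] at h1
      have h2 : (c ^ n - 1) • f n = 0 := by rw [sub_smul, one_smul, ← h1, sub_self]
      exact (smul_eq_zero_iff_right (sub_ne_zero.2 (hc n hn))).1 h2
  refine ⟨f 0, ?_⟩
  rw [hf, normalForm_single, ladder_zero]
  simp

/-- A coefficient commuting with `E` is invariant under the twisting automorphism. -/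
lemma fixed_of_commute_E (hinj : Function.Injective (normalForm i E F)) {σ : R ≃ₐ[ℂ] R}
    (hE : ∀ r, E * i r = i (σ.symm r) * E) {r : R} (hr : Commute (i r) E) : σ r = r := by
  have h : normalForm i E F (Finsupp.single 1 (σ.symm r)) =
      normalForm i E F (Finsupp.single 1 r) := by
    rw [normalForm_single, normalForm_single, ladder_one, ← hE, hr.eq]
  have := Finsupp.single_injective 1 (hinj h)
  rw [← this, AlgEquiv.apply_symm_apply, this]

lemma injective_of_normalForm_injective (hinj : Function.Injective (normalForm i E F)) :
    Function.Injective i := fun r s h => by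
  refine Finsupp.single_injective 0 (hinj ?_)
  rw [normalForm_single, normalForm_single, h]

end NormalForm

section Coefficients

/-- `scale c` as an automorphism. -/
def scaleEquiv {B : Type*} [CommRing B] [Algebra ℂ B] (c : ℂˣ) : B[T;T⁻¹] ≃ₐ[ℂ] B[T;T⁻¹] :=
  AlgEquiv.ofAlgHom (scale c) (scale c⁻¹)
    (AlgHom.ext fun r => by simp [scale_scale, scale_one])
    (AlgHom.ext fun r => by simp [scale_scale, scale_one])

lemma scaleEquiv_apply {B : Type*} [CommRing B] [Algebra ℂ B] (c : ℂˣ) (r : B[T;T⁻¹]) :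
    scaleEquiv c r = scale c r := rfl

lemma coef_algHom_ext {A : Type*} [Semiring A] [Algebra ℂ A] {f g : Coef →ₐ[ℂ] A}
    (hX : f (C Polynomial.X) = g (C Polynomial.X)) (hT : f (T 1) = g (T 1))
    (hH : f coefH = g coefH) : f = g := by
  let j : CenterRing →ₐ[ℂ] Coef := Algebra.algHom ℂ CenterRing Coef
  have hj : f.comp j = g.comp j := by
    refine Polynomial.algHom_ext' (laurent_algHom_ext (fun b => ?_) ?_) hX
    · exact ((f.comp j).commutes b).trans ((g.comp j).commutes b).symm
    · change f (C (Polynomial.C (T 1))) = g (C (Polynomial.C (T 1)))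
      rw [← coefH_mul_T, map_mul, map_mul, hT, hH]
  exact laurent_algHom_ext (fun b => DFunLike.congr_fun hj b) hT

variable {q : ℂ} {m : ℕ} {A : Type*} [Ring A] [Algebra ℂ A] {E F : A} {K H : Aˣ}

namespace UqRelations

lemma commute_casimir_KH (hq : q ≠ 0) (h : UqRelations q m E F K H) :
    Commute (casimir q m E F K H) (K * H : Aˣ) := by
  rw [Units.val_mul]
  exact (h.commute_casimir_K hq).mul_right (h.commute_casimir_H hq)

/-- The map from the polynomial ring `ℂ[y, y⁻¹][x]` sending `x` to the Casimir element and `y` to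
`KH`. -/
def centerMap (hq : q ≠ 0) (h : UqRelations q m E F K H) : CenterRing →ₐ[ℂ] A :=
  polyLaurentLift (casimir q m E F K H) (K * H) (h.commute_casimir_KH hq)

lemma commute_centerMap (hq : q ≠ 0) (h : UqRelations q m E F K H) {w : A}
    (hw : Commute (casimir q m E F K H) w) (hw' : Commute ((K * H : Aˣ) : A) w) (b : CenterRing) :
    Commute (h.centerMap hq b) w := by
  have : h.centerMap hq b ∈ Subalgebra.centralizer ℂ {w} :=
    polyLaurentLift_mem (by simpa [Subalgebra.mem_centralizer_iff] using hw.symm.eq)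
      (by simpa [Subalgebra.mem_centralizer_iff] using hw'.symm.eq)
      (by simpa only [Subalgebra.mem_centralizer_iff, Set.mem_singleton_iff, forall_eq]
        using (Commute.units_inv_left hw').symm.eq) b
  exact ((Subalgebra.mem_centralizer_iff ℂ).1 this w rfl).symm

/-- The map from the coefficient ring. -/
def coefMap (hq : q ≠ 0) (h : UqRelations q m E F K H) : Coef →ₐ[ℂ] A :=
  laurentLift (h.centerMap hq) K
    (h.commute_centerMap hq (h.commute_casimir_K hq) h.commute_KH_K)

lemma coefMap_C (hq : q ≠ 0) (h : UqRelations q m E F K H) (b : CenterRing) :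
    h.coefMap hq (C b) = h.centerMap hq b := laurentLift_C b

lemma coefMap_unitT (hq : q ≠ 0) (h : UqRelations q m E F K H) :
    h.coefMap hq (unitT 1 : Coefˣ) = K := by
  simpa [coefMap] using laurentLift_T (u := K) 1

lemma coefMap_coefH (hq : q ≠ 0) (h : UqRelations q m E F K H) : h.coefMap hq coefH = H := by
  rw [coefH_val, coefMap, laurentLift_C_mul_T, centerMap, polyLaurentLift_C_T, ← Units.val_mul]
  congr 1
  have : K * H = H * K := Units.ext (by simpa using h.KH)
  simp [this]

lemma coefMap_coefFE (hq : q ≠ 0) (h : UqRelations q m E F K H) :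
    h.coefMap hq (coefFE q m) = F * E := by
  have hK := h.coefMap_unitT hq
  rw [val_unitT] at hK
  rw [coefFE, map_sub, map_smul, map_add, map_smul, map_pow, map_pow, hK,
    h.coefMap_coefH, coefMap_C, centerMap, polyLaurentLift_X, casimir, add_sub_cancel_right]

lemma E_mul_coefMap (hq : q ≠ 0) (hm : q ^ (2 * m) ≠ 1) (h : UqRelations q m E F K H) {c : ℂˣ}
    (hc : (c : ℂ) = q ^ 2) (r : Coef) :
    E * h.coefMap hq r = h.coefMap hq ((scaleEquiv c).symm r) * E :=
  laurentLift_skew (h.commute_centerMap hq (h.commute_casimir_E hq hm) (h.commute_KH_E hq))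
    (hc ▸ h.KE) r

lemma F_mul_coefMap (hq : q ≠ 0) (hm : q ^ (2 * m) ≠ 1) (h : UqRelations q m E F K H) {c : ℂˣ}
    (hc : (c : ℂ) = q ^ 2) (r : Coef) :
    F * h.coefMap hq r = h.coefMap hq (scaleEquiv c r) * F := by
  have := laurentLift_skew (c := c⁻¹)
    (h := h.commute_centerMap hq (h.commute_casimir_K hq) h.commute_KH_K)
    (h.commute_centerMap hq (h.commute_casimir_F hq hm) (h.commute_KH_F hq))
    (by rw [Units.val_inv_eq_inv_val, hc]; exact h.KF) r
  rwa [inv_inv] at this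

lemma coefMap_EF (hq : q ≠ 0) (h : UqRelations q m E F K H) :
    E * F = h.coefMap hq
      (coefFE q m + (q - q⁻¹)⁻¹ • (((unitT 1 : Coefˣ) : Coef) ^ m - (coefH : Coef) ^ m)) := by
  rw [map_add, map_smul, map_sub, map_pow, map_pow, coefMap_unitT, coefMap_coefH, coefMap_coefFE,
    ← h.EF]
  abel

/-- Every element of an algebra generated by `E`, `F`, `K^{±1}`, `H^{±1}` has a normal form. -/
lemma normalForm_surjective (hq : q ≠ 0) (hm : q ^ (2 * m) ≠ 1) (h : UqRelations q m E F K H)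
    (hgen : ∀ S : Subalgebra ℂ A, E ∈ S → F ∈ S → (K : A) ∈ S → ((K⁻¹ : Aˣ) : A) ∈ S →
      (H : A) ∈ S → ((H⁻¹ : Aˣ) : A) ∈ S → S = ⊤) :
    Function.Surjective (normalForm (R := Coef) (h.coefMap hq) E F) := by
  let c : ℂˣ := Units.mk0 (q ^ 2) (pow_ne_zero _ hq)
  have hinv (u : Coefˣ) (v : Aˣ) (huv : h.coefMap hq u = v) :
      ((v⁻¹ : Aˣ) : A) = h.coefMap hq (u⁻¹ : Coefˣ) := by
    have : v = Units.map (h.coefMap hq).toMonoidHom u := Units.ext huv.symm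
    rw [this, ← map_inv]
    rfl
  refine _root_.normalForm_surjective (R := Coef) (σ := scaleEquiv c) (h.coefMap_EF hq)
    (h.coefMap_coefFE hq).symm (h.E_mul_coefMap hq hm rfl) (h.F_mul_coefMap hq hm rfl)
    fun S hE hF hS => hgen S hE hF (hS ⟨_, h.coefMap_unitT hq⟩) ?_ (hS ⟨_, h.coefMap_coefH hq⟩) ?_
  · exact hS ⟨_, (hinv _ _ (h.coefMap_unitT hq)).symm⟩
  · exact hS ⟨_, (hinv _ _ (h.coefMap_coefH hq)).symm⟩

/-- If the coefficients act faithfully in the left regular representation, then normal forms are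
unique. -/
lemma normalForm_injective (hq : q ≠ 0) (hm : q ^ (2 * m) ≠ 1)
    {R : Type} [CommRing R] [Algebra ℂ R] [IsDomain R] {σ : R ≃ₐ[ℂ] R} {k l : Rˣ} {x g : R}
    (hk : σ k = q ^ 2 • (k : R)) (hl : σ l = (q ^ 2)⁻¹ • (l : R)) (hx : σ x = x)
    (hg : g = x - casimirScalar q m • (q ^ (2 * m) • (k : R) ^ m + (l : R) ^ m)) (hg0 : g ≠ 0)
    (hext : ∀ f f' : R →ₐ[ℂ] Module.End ℂ (ℤ →₀ R), f x = f' x → f k = f' k → f l = f' l → f = f')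
    {i : R →ₐ[ℂ] A} (hix : i x = casimir q m E F K H) (hik : i k = K) (hil : i l = H)
    (huniv : ∀ {B : Type} [Ring B] [Algebra ℂ B] {E' F' : B} {K' H' : Bˣ},
      UqRelations q m E' F' K' H' → ∃ ρ : A →ₐ[ℂ] B, ρ E = E' ∧ ρ F = F' ∧ ρ K = K' ∧ ρ H = H') :
    Function.Injective (normalForm i E F) := by
  obtain ⟨ρ, hE, hF, hK, hH⟩ := huniv (uqRelations_op g hq hm hk hl hx hg)
  have hi : ρ.comp i = Algebra.lsmul ℂ ℂ (ℤ →₀ R) := by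
    refine hext _ _ ?_ ?_ ?_
    · rw [AlgHom.comp_apply, hix, casimir, map_add, map_smul, map_add, map_smul, map_mul, map_pow,
        map_pow, hE, hF, hK, hH, opF_mul_opE, opUnit_val, opUnit_val, ← map_pow, ← map_pow,
        ← map_smul, ← map_add, ← map_smul, ← map_add, hg, sub_add_cancel]
    · rw [AlgHom.comp_apply, hik, hK, opUnit_val]
    · rw [AlgHom.comp_apply, hil, hH, opUnit_val]
  exact _root_.normalForm_injective hg0 ρ hE hF fun r => DFunLike.congr_fun hi r

/-- Normal forms are unique in the universal algebra with the relations `UqRelations`. -/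
lemma normalForm_coefMap_injective (hq : q ≠ 0) (hm : q ^ (2 * m) ≠ 1) (hm0 : m ≠ 0)
    (h : UqRelations q m E F K H)
    (huniv : ∀ {B : Type} [Ring B] [Algebra ℂ B] {E' F' : B} {K' H' : Bˣ},
      UqRelations q m E' F' K' H' → ∃ ρ : A →ₐ[ℂ] B, ρ E = E' ∧ ρ F = F' ∧ ρ K = K' ∧ ρ H = H') :
    Function.Injective (normalForm (R := Coef) (h.coefMap hq) E F) := by
  let c : ℂˣ := Units.mk0 (q ^ 2) (pow_ne_zero _ hq)
  have key := UqRelations.normalForm_injective (R := Coef) (σ := scaleEquiv c)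
    (k := (unitT 1 : Coefˣ)) (l := coefH) (x := C Polynomial.X) (g := coefFE q m)
    (i := h.coefMap hq) (E := E) (F := F) (K := K) (H := H) hq hm
  refine key ?_ ?_ ?_ ?_ (coefFE_ne_zero q hm0) ?_ ?_ (h.coefMap_unitT hq) (h.coefMap_coefH hq) huniv
  · rw [scaleEquiv_apply, val_unitT, scale_T, zpow_one, Units.val_mk0]
  · rw [scaleEquiv_apply, scale_coefH, Units.val_mk0]
  · rw [scaleEquiv_apply, scale_C]
  · rw [coefFE, val_unitT]
  · exact fun f f' hX hT hH => coef_algHom_ext hX hT hH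
  · rw [coefMap_C, centerMap, polyLaurentLift_X]

end UqRelations

end Coefficients

section Um

variable (q : ℂ) (m : ℕ)

lemma Um_rel {a b : FA} (h : URel q (fm q m) a b) :
    RingQuot.mkAlgHom ℂ (URel q (fm q m)) a = RingQuot.mkAlgHom ℂ (URel q (fm q m)) b :=
  RingQuot.mkAlgHom_rel ℂ h

/-- The generator `K` as a unit. -/
def unitK : (Um q m)ˣ where
  val := uK q (fm q m)
  inv := uKi q (fm q m)
  val_inv := by
    have h := Um_rel q m URel.KKi
    rw [map_mul, map_one] at h
    exact h
  inv_val := by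
    have h := Um_rel q m URel.KiK
    rw [map_mul, map_one] at h
    exact h

/-- The generator `H` as a unit. -/
def unitH : (Um q m)ˣ where
  val := uH q (fm q m)
  inv := uHi q (fm q m)
  val_inv := by
    have h := Um_rel q m URel.HHi
    rw [map_mul, map_one] at h
    exact h
  inv_val := by
    have h := Um_rel q m URel.HiH
    rw [map_mul, map_one] at h
    exact h

lemma uqRelations_Um :
    UqRelations q m (uE q (fm q m)) (uF q (fm q m)) (unitK q m) (unitH q m) where
  KH := by
    have h := Um_rel q m URel.KH
    rw [map_mul, map_mul] at h
    exact h
  KE := by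
    have h := Um_rel q m URel.KE
    rw [map_mul, map_smul, map_mul] at h
    exact h
  KF := by
    have h := Um_rel q m URel.KF
    rw [map_mul, map_smul, map_mul] at h
    exact h
  HE := by
    have h := Um_rel q m URel.HE
    rw [map_mul, map_smul, map_mul] at h
    exact h
  HF := by
    have h := Um_rel q m URel.HF
    rw [map_mul, map_smul, map_mul] at h
    exact h
  EF := by
    have h := Um_rel q m URel.EF
    rw [map_sub, map_mul, map_mul] at h
    refine h.trans ?_
    change RingQuot.mkAlgHom ℂ (URel q (fm q m)) ((q - q⁻¹)⁻¹ • (gK ^ m - gH ^ m)) = _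
    rw [map_smul, map_sub, map_pow, map_pow]
    rfl

lemma Om_eq_casimir :
    Om q m = casimir q m (uE q (fm q m)) (uF q (fm q m)) (unitK q m) (unitH q m) := rfl

lemma Um_generated (S : Subalgebra ℂ (Um q m)) (hE : uE q (fm q m) ∈ S) (hF : uF q (fm q m) ∈ S)
    (hK : (unitK q m : Um q m) ∈ S) (hK' : (((unitK q m)⁻¹ : (Um q m)ˣ) : Um q m) ∈ S)
    (hH : (unitH q m : Um q m) ∈ S) (hH' : (((unitH q m)⁻¹ : (Um q m)ˣ) : Um q m) ∈ S) :
    S = ⊤ := by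
  refine eq_top_iff.2 fun z _ => ?_
  obtain ⟨a, rfl⟩ := RingQuot.mkAlgHom_surjective ℂ (URel q (fm q m)) z
  induction a using FreeAlgebra.induction with
  | grade0 r => rw [AlgHom.commutes]; exact S.algebraMap_mem r
  | grade1 x => cases x <;> assumption
  | mul a b ha hb => rw [map_mul]; exact S.mul_mem (ha trivial) (hb trivial)
  | add a b ha hb => rw [map_add]; exact S.add_mem (ha trivial) (hb trivial)

lemma Um_universal {A : Type*} [Ring A] [Algebra ℂ A] {E F : A} {K H : Aˣ}
    (h : UqRelations q m E F K H) :
    ∃ ρ : Um q m →ₐ[ℂ] A, ρ (uE q (fm q m)) = E ∧ ρ (uF q (fm q m)) = F ∧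
      ρ (unitK q m : Um q m) = K ∧ ρ (unitH q m : Um q m) = H := by
  let v : Gen → A
    | Gen.E => E
    | Gen.F => F
    | Gen.K => K
    | Gen.Kinv => (K⁻¹ : Aˣ)
    | Gen.H => H
    | Gen.Hinv => (H⁻¹ : Aˣ)
  have hE : FreeAlgebra.lift ℂ v gE = E := FreeAlgebra.lift_ι_apply v Gen.E
  have hF : FreeAlgebra.lift ℂ v gF = F := FreeAlgebra.lift_ι_apply v Gen.F
  have hK : FreeAlgebra.lift ℂ v gK = K := FreeAlgebra.lift_ι_apply v Gen.K
  have hKi : FreeAlgebra.lift ℂ v gKi = (K⁻¹ : Aˣ) := FreeAlgebra.lift_ι_apply v Gen.Kinv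
  have hH : FreeAlgebra.lift ℂ v gH = H := FreeAlgebra.lift_ι_apply v Gen.H
  have hHi : FreeAlgebra.lift ℂ v gHi = (H⁻¹ : Aˣ) := FreeAlgebra.lift_ι_apply v Gen.Hinv
  have hrel : ∀ ⦃a b : FA⦄, URel q (fm q m) a b →
      FreeAlgebra.lift ℂ v a = FreeAlgebra.lift ℂ v b := by
    intro a b hab
    cases hab <;>
      simp only [map_mul, map_one, map_smul, map_sub, map_pow, fm, hE, hF, hK, hKi, hH, hHi,
        h.KH, h.KE, h.KF, h.HE, h.HF, h.EF, Units.mul_inv, Units.inv_mul]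
  refine ⟨RingQuot.liftAlgHom ℂ ⟨FreeAlgebra.lift ℂ v, hrel⟩, ?_, ?_, ?_, ?_⟩
  · exact (RingQuot.liftAlgHom_mkAlgHom_apply ℂ _ _ _).trans hE
  · exact (RingQuot.liftAlgHom_mkAlgHom_apply ℂ _ _ _).trans hF
  · exact (RingQuot.liftAlgHom_mkAlgHom_apply ℂ _ _ _).trans hK
  · exact (RingQuot.liftAlgHom_mkAlgHom_apply ℂ _ _ _).trans hH

variable {q m}

lemma Um_normalForm_bijective (hq : q ≠ 0) (hm : q ^ (2 * m) ≠ 1) (hm0 : m ≠ 0) :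
    Function.Bijective (normalForm (R := Coef) ((uqRelations_Um q m).coefMap hq)
      (uE q (fm q m)) (uF q (fm q m))) :=
  ⟨(uqRelations_Um q m).normalForm_coefMap_injective hq hm hm0 (Um_universal q m),
    (uqRelations_Um q m).normalForm_surjective hq hm (Um_generated q m)⟩

lemma Um_range_centerMap (hq : q ≠ 0) (hroot : ∀ n : ℕ, 0 < n → q ^ n ≠ 1) (hm0 : m ≠ 0) :
    ((uqRelations_Um q m).centerMap hq).range = Subalgebra.center ℂ (Um q m) := by
  have hm : q ^ (2 * m) ≠ 1 := hroot _ (by omega)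
  have h := uqRelations_Um q m
  obtain ⟨hinj, hsurj⟩ := Um_normalForm_bijective hq hm hm0
  let c : ℂˣ := Units.mk0 (q ^ 2) (pow_ne_zero _ hq)
  have hc (n : ℤ) (hn : n ≠ 0) : (q ^ 2) ^ n ≠ 1 := by
    intro h1
    obtain ⟨k, rfl | rfl⟩ := n.eq_nat_or_neg
    · rw [zpow_natCast, ← pow_mul] at h1
      exact hroot _ (by omega) h1
    · rw [zpow_neg, inv_eq_one, zpow_natCast, ← pow_mul] at h1
      exact hroot _ (by omega) h1
  refine le_antisymm ?_ fun z hz => ?_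
  · rintro _ ⟨b, rfl⟩
    have hcent {w : Um q m} (hw : Commute (casimir q m (uE q (fm q m)) (uF q (fm q m))
        (unitK q m) (unitH q m)) w)
        (hw' : Commute ((unitK q m * unitH q m : (Um q m)ˣ) : Um q m) w) :
        w ∈ Subalgebra.centralizer ℂ {h.centerMap hq b} := by
      simpa [Subalgebra.mem_centralizer_iff] using (h.commute_centerMap hq hw hw' b).eq
    have htop := Um_generated q m (Subalgebra.centralizer ℂ {h.centerMap hq b})
      (hcent (h.commute_casimir_E hq hm) (h.commute_KH_E hq))
      (hcent (h.commute_casimir_F hq hm) (h.commute_KH_F hq))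
      (hcent (h.commute_casimir_K hq) h.commute_KH_K)
      (hcent (h.commute_casimir_K hq).units_inv_right h.commute_KH_K.units_inv_right)
      (hcent (h.commute_casimir_H hq) h.commute_KH_H)
      (hcent (h.commute_casimir_H hq).units_inv_right h.commute_KH_H.units_inv_right)
    refine Subalgebra.mem_center_iff.2 fun w => ?_
    have hw : w ∈ Subalgebra.centralizer ℂ {h.centerMap hq b} := htop ▸ Algebra.mem_top
    exact ((Subalgebra.mem_centralizer_iff ℂ).1 hw _ rfl).symm
  · have hz' (w : Um q m) : Commute z w := (Subalgebra.mem_center_iff.1 hz w).symm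
    obtain ⟨r, rfl⟩ := exists_of_commute_K (R := Coef) hinj hsurj (h.coefMap_unitT hq) hc
      h.KE h.KF (hz' _)
    have hr := fixed_of_commute_E (R := Coef) (σ := scaleEquiv c) hinj
      (h.E_mul_coefMap hq hm rfl) (hz' _)
    have hrC := eq_C_of_scale_eq (c := c)
      (fun n hn h1 => hc n hn (by simpa [c] using congrArg Units.val h1)) hr
    rw [hrC, h.coefMap_C]
    exact ⟨_, rfl⟩

lemma Um_centerMap_injective (hq : q ≠ 0) (hm : q ^ (2 * m) ≠ 1) (hm0 : m ≠ 0) :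
    Function.Injective ((uqRelations_Um q m).centerMap hq) := by
  have hi := injective_of_normalForm_injective (R := Coef)
    (Um_normalForm_bijective hq hm hm0).injective
  intro a b hab
  rw [← UqRelations.coefMap_C, ← UqRelations.coefMap_C] at hab
  simpa using congrArg (fun r : Coef => r.coeff 0) (hi hab)

end Um

end

/-- The center `Z(U)` of `U = U_q(f_m(K,H))` is the subalgebra generated by
`Ω`, `KH` and `(KH)⁻¹ = K⁻¹H⁻¹`; moreover the ℂ-algebra homomorphism from
`ℂ[x][y,y⁻¹]` (polynomials in `x` with Laurent-polynomial coefficients in `y`)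
sending `x ↦ Ω`, `y ↦ KH` is injective with image `Z(U)`. -/
theorem stmt12 (q : ℂ) (hq0 : q ≠ 0) (hq : ∀ n : ℕ, 0 < n → q ^ n ≠ 1)
    (m : ℕ) (hm : 1 ≤ m) :
    Subalgebra.center ℂ (Um q m) =
      Algebra.adjoin ℂ ({Om q m, uK q (fm q m) * uH q (fm q m),
        uKi q (fm q m) * uHi q (fm q m)} : Set (Um q m)) ∧
    ∃ φ : Polynomial (LaurentPolynomial ℂ) →ₐ[ℂ] Um q m,
      φ Polynomial.X = Om q m ∧
      φ (Polynomial.C (LaurentPolynomial.T 1)) = uK q (fm q m) * uH q (fm q m) ∧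
      Function.Injective φ ∧
      φ.range = Subalgebra.center ℂ (Um q m) := by
  have hm0 : m ≠ 0 := by omega
  have hm' : q ^ (2 * m) ≠ 1 := hq _ (by omega)
  have h := uqRelations_Um q m
  have hrange := Um_range_centerMap hq0 hq hm0
  have hX : h.centerMap hq0 Polynomial.X = Om q m := polyLaurentLift_X
  have hT (n : ℤ) : h.centerMap hq0 (Polynomial.C (LaurentPolynomial.T n)) =
      ((unitK q m * unitH q m) ^ n : (Um q m)ˣ) := polyLaurentLift_C_T n
  have hy : (unitK q m * unitH q m : (Um q m)ˣ) = uK q (fm q m) * uH q (fm q m) := rfl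
  have hy' : (((unitK q m * unitH q m)⁻¹ : (Um q m)ˣ) : Um q m) =
      uKi q (fm q m) * uHi q (fm q m) := by
    have : unitK q m * unitH q m = unitH q m * unitK q m := Units.ext h.KH
    rw [this, mul_inv_rev]
    rfl
  refine ⟨?_, h.centerMap hq0, hX, ?_, Um_centerMap_injective hq0 hm' hm0, hrange⟩
  · refine le_antisymm ?_ (Algebra.adjoin_le ?_)
    · rw [← hrange]
      rintro _ ⟨b, rfl⟩
      exact polyLaurentLift_mem (Algebra.subset_adjoin (by simp [Om_eq_casimir]))
        (Algebra.subset_adjoin (by simp [hy])) (Algebra.subset_adjoin (by rw [hy']; simp)) b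
    · rw [← hrange]
      rintro _ (rfl | rfl | rfl)
      · exact ⟨_, hX⟩
      · exact ⟨_, (hT 1).trans (by rw [zpow_one, hy])⟩
      · exact ⟨_, (hT (-1)).trans (by rw [zpow_neg_one, hy'])⟩
  · exact (hT 1).trans (by rw [zpow_one, hy])
end
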